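/- Fix an integer s ≥ 5 and a positive integer k with (k+s−1)(s+1) ≤ 2^s − 1. Let X ⊂ ℙ^{2^s−1} be the Segre embedding of (ℙ^1)^s over an algebraically closed field of characteristic 0. Then X is not weakly k-defective, and hence it is k-identifiable. -/

import Mathlib

noncomputable section

namespace ContactLoci

variable {K : Type*} [Field K] {ι : Type*} [Fintype ι]

/-- Projective space over `K` with homogeneous coordinates indexed by `ι`. -/
abbrev PP (K : Type*) [Field K] (ι : Type*) : Type _ :=
  Projectivization K (ι → K)

/-- The affine cone over a set of projective points. -/
def coneOf (S : Set (PP K ι)) : Set (ι → K) :=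
  ⋃ x ∈ S, (x.submodule : Set (ι → K))

/-- The linear span, in the underlying vector space, of the cone over `S`. -/
def vspan (S : Set (PP K ι)) : Submodule K (ι → K) :=
  Submodule.span K (coneOf S)

/-- The projective linear span of a set of projective points. -/
def projSpan (S : Set (PP K ι)) : Set (PP K ι) :=
  {x | x.submodule ≤ vspan S}

/-- The projective dimension of the linear span of `S` (`-1` for `S = ∅`). -/
def projDim (S : Set (PP K ι)) : ℤ :=
  (Module.finrank K (vspan S) : ℤ) - 1

/-- A set of projective points is non-degenerate if its linear span is everything. -/
def Nondegenerate (S : Set (PP K ι)) : Prop :=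
  vspan S = ⊤

/-- The common zero locus in projective space of a set of polynomials. -/
def zeroLocus (S : Set (MvPolynomial ι K)) : Set (PP K ι) :=
  {x | ∀ f ∈ S, ∀ v ∈ x.submodule, MvPolynomial.eval v f = 0}

/-- Zariski-closed subsets of projective space: common zero loci of sets of
homogeneous polynomials. -/
def IsZClosed (X : Set (PP K ι)) : Prop :=
  ∃ S : Set (MvPolynomial ι K), (∀ f ∈ S, ∃ d : ℕ, f.IsHomogeneous d) ∧ X = zeroLocus S

/-- Zariski closure. -/
def zclosure (S : Set (PP K ι)) : Set (PP K ι) :=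
  ⋂₀ {Y | IsZClosed Y ∧ S ⊆ Y}

/-- Irreducibility with respect to the Zariski topology. -/
def IsZIrreducible (S : Set (PP K ι)) : Prop :=
  S.Nonempty ∧ ∀ Y Z : Set (PP K ι), IsZClosed Y → IsZClosed Z → S ⊆ Y ∪ Z → S ⊆ Y ∨ S ⊆ Z

/-- An integral projective variety: a Zariski-closed irreducible subset. -/
def IsIntegralVariety (X : Set (PP K ι)) : Prop :=
  IsZClosed X ∧ IsZIrreducible X

/-- `C` is an irreducible component of `S`: a maximal irreducible subset of `S`. -/
def IsZIrredComponent (S C : Set (PP K ι)) : Prop :=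
  IsZIrreducible C ∧ C ⊆ S ∧ ∀ D : Set (PP K ι), IsZIrreducible D → D ⊆ S → C ⊆ D → C = D

/-- The dimension of a set: the Krull dimension of the poset of irreducible
Zariski-closed subsets of its Zariski closure (`⊥` for the empty set). -/
def zdim (S : Set (PP K ι)) : WithBot ℕ∞ :=
  Order.krullDim ({Y : Set (PP K ι) // IsZClosed Y ∧ IsZIrreducible Y ∧ Y ⊆ zclosure S})

/-- A property holds at a general point of `X`: it holds away from a proper
Zariski-closed subset. -/
def HoldsGenerically (X : Set (PP K ι)) (P : PP K ι → Prop) : Prop :=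
  ∃ Y : Set (PP K ι), IsZClosed Y ∧ ¬X ⊆ Y ∧ ∀ x ∈ X \ Y, P x

/-- Zero locus of multihomogeneous polynomials in a self-product of projective space. -/
def multiZeroLocus {m : ℕ} (S : Set (MvPolynomial (Fin m × ι) K)) :
    Set (Fin m → PP K ι) :=
  {u | ∀ f ∈ S, ∀ v : Fin m → ι → K, (∀ i, v i ∈ (u i).submodule) →
    MvPolynomial.eval (fun p => v p.1 p.2) f = 0}

/-- Zariski-closed subsets of the `m`-fold self-product of projective space. -/
def IsMultiZClosed {m : ℕ} (T : Set (Fin m → PP K ι)) : Prop :=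
  ∃ S : Set (MvPolynomial (Fin m × ι) K),
    (∀ f ∈ S, ∀ i : Fin m, ∃ d : ℕ,
      MvPolynomial.IsWeightedHomogeneous (fun p : Fin m × ι => if p.1 = i then 1 else 0) f d) ∧
    T = multiZeroLocus S

/-- A property holds for a general `m`-tuple of points of `X`. -/
def HoldsForGeneralTuples (X : Set (PP K ι)) (m : ℕ) (P : (Fin m → PP K ι) → Prop) : Prop :=
  ∃ T : Set (Fin m → PP K ι), IsMultiZClosed T ∧
    (∃ u : Fin m → PP K ι, (∀ i, u i ∈ X) ∧ u ∉ T) ∧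
    ∀ u : Fin m → PP K ι, (∀ i, u i ∈ X) → u ∉ T → P u

/-- The homogeneous vanishing ideal of `X` (as a set of homogeneous polynomials). -/
def homogVanishingIdeal (X : Set (PP K ι)) : Set (MvPolynomial ι K) :=
  {f | (∃ d : ℕ, f.IsHomogeneous d) ∧ ∀ x ∈ X, ∀ v ∈ x.submodule, MvPolynomial.eval v f = 0}

/-- The embedded (projective) tangent space of `X` at `x`. -/
def embTangentSpace (X : Set (PP K ι)) (x : PP K ι) : Set (PP K ι) :=
  {y | ∀ f ∈ homogVanishingIdeal X,
    ∑ i : ι, y.rep i * MvPolynomial.eval x.rep (MvPolynomial.pderiv i f) = 0}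

/-- Smooth points of `X`. -/
def IsSmoothPoint (X : Set (PP K ι)) (x : PP K ι) : Prop :=
  x ∈ X ∧ zdim (embTangentSpace X x) = zdim X

/-- `M_A`: the linear span of the tangent spaces of `X` at the points of `A`. -/
def tangentSpan (X A : Set (PP K ι)) : Set (PP K ι) :=
  projSpan (⋃ a ∈ A, embTangentSpace X a)

/-- The locus of smooth points of `X` at which `M_A` is tangent to `X`. -/
def tangencyLocus (X A : Set (PP K ι)) : Set (PP K ι) :=
  {x | IsSmoothPoint X x ∧ embTangentSpace X x ⊆ tangentSpan X A}

/-- The tangential contact locus of `X` at `A`: the closure of the union of the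
irreducible components of the tangency locus meeting `A`. -/
def contactLocus (X A : Set (PP K ι)) : Set (PP K ι) :=
  zclosure (⋃ C ∈ {C : Set (PP K ι) |
    IsZIrredComponent (tangencyLocus X A) C ∧ (C ∩ A).Nonempty}, C)

/-- `X` is weakly `k`-defective: the tangential contact locus at `k` general points
has positive dimension. -/
def WeaklyDefective (X : Set (PP K ι)) (k : ℕ) : Prop :=
  HoldsForGeneralTuples X k fun u => 0 < zdim (contactLocus X (Set.range u))

/-- The `k`-th secant variety of `X`. -/
def secant (k : ℕ) (X : Set (PP K ι)) : Set (PP K ι) :=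
  zclosure {q | ∃ S : Finset (PP K ι), ↑S ⊆ X ∧ S.card = k ∧ q ∈ projSpan (S : Set (PP K ι))}

/-- The `X`-rank of a point. -/
def xrank (X : Set (PP K ι)) (q : PP K ι) : ℕ :=
  sInf {k | ∃ S : Finset (PP K ι), ↑S ⊆ X ∧ S.card = k ∧ q ∈ projSpan (S : Set (PP K ι))}

/-- `𝒮(q,X)`: the set of minimal `X`-decompositions of `q`. -/
def decompositions (X : Set (PP K ι)) (q : PP K ι) : Set (Finset (PP K ι)) :=
  {S | ↑S ⊆ X ∧ S.card = xrank X q ∧ q ∈ projSpan (S : Set (PP K ι))}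

/-- `X` is `k`-identifiable: a general point of `σ_k(X)` has a unique minimal
decomposition. -/
def Identifiable (X : Set (PP K ι)) (k : ℕ) : Prop :=
  HoldsGenerically (secant k X) fun q => ∃! S : Finset (PP K ι), S ∈ decompositions X q

/-- `α` is the `k`-th secant degree of `X`. -/
def HasSecantDegree (X : Set (PP K ι)) (k α : ℕ) : Prop :=
  HoldsGenerically (secant k X) fun q => (decompositions X q).ncard = α

/-- Projective linear subspaces. -/
def IsProjLinear (L : Set (PP K ι)) : Prop :=
  L = projSpan L

/-- Lines in projective space. -/
def IsLine (L : Set (PP K ι)) : Prop :=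
  IsProjLinear L ∧ Module.finrank K (vspan L) = 2

/-- `X` is uniruled by lines: through a general point of `X` there is a line
contained in `X`. -/
def UniruledByLines (X : Set (PP K ι)) : Prop :=
  HoldsGenerically X fun x => ∃ L : Set (PP K ι), IsLine L ∧ x ∈ L ∧ L ⊆ X

/-- The join of two sets in projective space. -/
def join (A B : Set (PP K ι)) : Set (PP K ι) :=
  zclosure (⋃ a ∈ A, ⋃ b ∈ B, projSpan {a, b})

/-- The linear space `M` is tangent to `X` along `W`. -/
def TangentAlong (M X W : Set (PP K ι)) : Prop :=
  ∀ x ∈ W, IsSmoothPoint X x → embTangentSpace X x ⊆ M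

/-- `S` has exactly `m` irreducible components, all of them projective linear
subspaces, and these components are linearly independent. -/
def ComponentsAreIndepLinear (S : Set (PP K ι)) (m : ℕ) : Prop :=
  ∃ C : Fin m → Set (PP K ι), Function.Injective C ∧
    (∀ D : Set (PP K ι), IsZIrredComponent S D ↔ ∃ i, D = C i) ∧
    (∀ i, IsProjLinear (C i)) ∧
    Module.finrank K (vspan S) = ∑ i, Module.finrank K (vspan (C i))


/-- The Segre variety: the image of `ℙ^{n 1} × ⋯ × ℙ^{n s}` under the Segre
embedding, given by the complete linear system `|O(1,…,1)|`. -/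
def segreVariety (K : Type*) [Field K] (s : ℕ) (n : Fin s → ℕ) :
    Set (PP K (∀ i : Fin s, Fin (n i + 1))) :=
  {x | ∃ u : ∀ i : Fin s, Fin (n i + 1) → K,
    x.submodule = Submodule.span K
      ({fun t => ∏ i, u i (t i)} : Set ((∀ i : Fin s, Fin (n i + 1)) → K))}

/-- The projection of `L ⊆ Segre` to the `i`-th factor is a single point, i.e. `L`
lies in a single fiber of the `i`-th projection. -/
def SegreFactorIsPoint (K : Type*) [Field K] (s : ℕ) (n : Fin s → ℕ) (i : Fin s)
    (L : Set (PP K (∀ j : Fin s, Fin (n j + 1)))) : Prop :=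
  ∃ w : Fin (n i + 1) → K, w ≠ 0 ∧ ∀ x ∈ L,
    ∃ u : ∀ j : Fin s, Fin (n j + 1) → K,
      x.submodule = Submodule.span K
        ({fun t => ∏ j, u j (t j)} : Set ((∀ j : Fin s, Fin (n j + 1)) → K)) ∧
      u i ∈ Submodule.span K ({w} : Set (Fin (n i + 1) → K))

/-- Index type for the Segre–Veronese embedding of multidegree `d`:
multi-indices of degree `d i` in the homogeneous variables of the `i`-th factor. -/
abbrev svIndex (s : ℕ) (n d : Fin s → ℕ) : Type :=
  ∀ i : Fin s, {w : Fin (n i + 1) → Fin (d i + 1) // ∑ j, (w j : ℕ) = d i}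

/-- The Segre–Veronese variety of multidegree `d`: the image of
`ℙ^{n 1} × ⋯ × ℙ^{n s}` under the embedding by `|L_1^{d 1} ⊗ ⋯ ⊗ L_s^{d s}|`. -/
def segreVeroneseVariety (K : Type*) [Field K] (s : ℕ) (n d : Fin s → ℕ) :
    Set (PP K (svIndex s n d)) :=
  {x | ∃ u : ∀ i : Fin s, Fin (n i + 1) → K,
    x.submodule = Submodule.span K
      ({fun t => ∏ i, ∏ j, u i j ^ ((t i).1 j : ℕ)} : Set (svIndex s n d → K))}

/-- The vector of the moments of degree `≤ d` of the one-dimensional Gaussian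
distribution with mean `μ` and variance `t`. -/
def gaussMomentVec (K : Type*) [Field K] (d : ℕ) (μ t : K) : Fin (d + 1) → K := fun i =>
  ∑ j ∈ Finset.range ((i : ℕ) / 2 + 1),
    ((Nat.choose (i : ℕ) (2 * j) * Nat.doubleFactorial (2 * j - 1) : ℕ) : K) *
      t ^ j * μ ^ ((i : ℕ) - 2 * j)

/-- The Gaussian moment variety `𝒢_{1,d} ⊆ ℙ^d`. -/
def gaussianMomentVariety (K : Type*) [Field K] (d : ℕ) : Set (PP K (Fin (d + 1))) :=
  zclosure {x | ∃ μ t : K,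
    x.submodule = Submodule.span K ({gaussMomentVec K d μ t} : Set (Fin (d + 1) → K))}

/-- Zariski-closed families of `m`-tuples of coefficient vectors of linear forms. -/
def IsAffineClosedFamily {m : ℕ} (T : Set (Fin m → ι → K)) : Prop :=
  ∃ S : Set (MvPolynomial (Fin m × ι) K),
    T = {h | ∀ f ∈ S, MvPolynomial.eval (fun p => h p.1 p.2) f = 0}

/-- The linear subspace cut out by the `m` linear forms with coefficient vectors `h`. -/
def linearSlice {m : ℕ} (h : Fin m → ι → K) : Set (PP K ι) :=
  {x | ∀ j : Fin m, ∑ i : ι, h j i * x.rep i = 0}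

/-- `x` lies on the hyperplane with coefficient vector `f`. -/
def inHyperplane (f : ι → K) (x : PP K ι) : Prop :=
  ∑ i : ι, f i * x.rep i = 0

/-- `X ⊆ ℙ^r` (of dimension `n`, `r + 1 = card ι`) is very strange: for a general
codimension-`n` linear subspace `M`, some `r - n + 2` points of `X ∩ M` lie in a
hyperplane of `M`, i.e. in a linear subspace of projective dimension `r - n - 1`. -/
def VeryStrange (n : ℕ) (X : Set (PP K ι)) : Prop :=
  ∃ T : Set (Fin n → ι → K), IsAffineClosedFamily T ∧ (∃ h, h ∉ T) ∧
    ∀ h : Fin n → ι → K, h ∉ T →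
      ∃ A : Finset (PP K ι), ↑A ⊆ X ∩ linearSlice h ∧
        A.card = Fintype.card ι + 1 - n ∧
        Module.finrank K (vspan (A : Set (PP K ι))) ≤ Fintype.card ι - 1 - n

section aux
open Finset Function
universe u

section basics
variable {R : Type*} [CommRing R] {s : ℕ}

/-- the rank one tensor with affine coordinates `x` -/
def av (x : Fin s → R) (t : Fin s → Fin 2) : R := ∏ l, if t l = 0 then 1 else x l

def dav (l : Fin s) (x : Fin s → R) (t : Fin s → Fin 2) : R :=
  av (update x l 1) t - av (update x l 0) t

def ddav (m l : Fin s) (x : Fin s → R) (t : Fin s → Fin 2) : R :=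
  dav l (update x m 1) t - dav l (update x m 0) t

theorem av_update (x : Fin s → R) (l : Fin s) (c : R) (t : Fin s → Fin 2) :
    av (update x l c) t = (if t l = 0 then 1 else c) *
      ∏ j ∈ univ.erase l, if t j = 0 then 1 else x j := by
  unfold av
  rw [← Finset.mul_prod_erase univ _ (Finset.mem_univ l)]
  congr 1
  · simp
  · apply Finset.prod_congr rfl
    intro j hj
    rw [update_of_ne (Finset.ne_of_mem_erase hj)]

theorem dav_eq (x : Fin s → R) (l : Fin s) (t : Fin s → Fin 2) :
    dav l x t = (if t l = 0 then 0 else 1) *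
      ∏ j ∈ univ.erase l, if t j = 0 then 1 else x j := by
  unfold dav
  rw [av_update, av_update]
  split_ifs <;> ring

theorem av_update' (x : Fin s → R) (l : Fin s) (c : R) (t : Fin s → Fin 2) :
    av (update x l c) t = av (update x l 0) t + c * dav l x t := by
  rw [dav_eq, av_update, av_update]
  split_ifs <;> ring

theorem av_update_sub (x : Fin s → R) (l : Fin s) (c d : R) (t : Fin s → Fin 2) :
    av (update x l c) t - av (update x l d) t = (c - d) * dav l x t := by
  rw [av_update' x l c, av_update' x l d]; ring

theorem dav_update_self (x : Fin s → R) (l : Fin s) (c : R) (t : Fin s → Fin 2) :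
    dav l (update x l c) t = dav l x t := by
  simp [dav]

theorem dav_update_sub (x : Fin s → R) (m l : Fin s) (c d : R) (t : Fin s → Fin 2) :
    dav l (update x m c) t - dav l (update x m d) t = (c - d) * ddav m l x t := by
  by_cases h : m = l
  · subst h; simp [ddav, dav_update_self]
  · unfold ddav dav
    have h1 := av_update_sub (update x l 1) m c d t
    have h2 := av_update_sub (update x l 0) m c d t
    have h3 := av_update_sub (update x l 1) m 1 0 t
    have h4 := av_update_sub (update x l 0) m 1 0 t
    simp only [update_comm (Ne.symm h)] at h1 h2 h3 h4 ⊢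
    linear_combination h1 - h2 - (c - d) * (h3 - h4)

theorem map_av {S : Type*} [CommRing S] (φ : R →+* S) (x : Fin s → R) (t) :
    φ (av x t) = av (fun l => φ (x l)) t := by
  simp only [av, map_prod]
  refine Finset.prod_congr rfl fun l _ => ?_
  split_ifs <;> simp

theorem comp_update {S : Type*} [CommRing S] (φ : R →+* S) (x : Fin s → R) (l : Fin s) (c : R) :
    (fun j => φ (update x l c j)) = update (fun j => φ (x j)) l (φ c) := by
  ext j; by_cases h : j = l
  · subst h; simp
  · simp [h]

theorem map_dav {S : Type*} [CommRing S] (φ : R →+* S) (l) (x : Fin s → R) (t) :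
    φ (dav l x t) = dav l (fun l => φ (x l)) t := by
  simp [dav, map_av, comp_update]

theorem map_ddav {S : Type*} [CommRing S] (φ : R →+* S) (m l) (x : Fin s → R) (t) :
    φ (ddav m l x t) = ddav m l (fun l => φ (x l)) t := by
  simp [ddav, map_dav, comp_update]

theorem av_cons (c : R) (x : Fin s → R) (t : Fin (s + 1) → Fin 2) :
    av (Fin.cons c x : Fin (s + 1) → R) t = (if t 0 = 0 then 1 else c) * av x (Fin.tail t) := by
  unfold av
  rw [Fin.prod_univ_succ]
  simp only [Fin.cons_zero, Fin.cons_succ]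
  rfl

theorem dav_zero_cons (c : R) (x : Fin s → R) (t : Fin (s + 1) → Fin 2) :
    dav 0 (Fin.cons c x : Fin (s + 1) → R) t = (if t 0 = 0 then 0 else 1) * av x (Fin.tail t) := by
  simp only [dav, Fin.update_cons_zero, av_cons]
  split_ifs <;> ring

theorem dav_succ_cons (c : R) (x : Fin s → R) (l : Fin s) (t : Fin (s + 1) → Fin 2) :
    dav l.succ (Fin.cons c x : Fin (s + 1) → R) t =
      (if t 0 = 0 then 1 else c) * dav l x (Fin.tail t) := by
  simp only [dav, ← Fin.cons_update, av_cons]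
  split_ifs <;> ring

theorem ddav_zero_zero (c : R) (x : Fin s → R) (t : Fin (s + 1) → Fin 2) :
    ddav 0 0 (Fin.cons c x : Fin (s + 1) → R) t = 0 := by
  simp [ddav, dav_zero_cons]

theorem ddav_zero_succ (c : R) (x : Fin s → R) (l : Fin s) (t : Fin (s + 1) → Fin 2) :
    ddav 0 l.succ (Fin.cons c x : Fin (s + 1) → R) t =
      (if t 0 = 0 then 0 else 1) * dav l x (Fin.tail t) := by
  simp only [ddav, Fin.update_cons_zero, dav_succ_cons]
  split_ifs <;> ring

theorem ddav_succ_zero (c : R) (x : Fin s → R) (l : Fin s) (t : Fin (s + 1) → Fin 2) :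
    ddav l.succ 0 (Fin.cons c x : Fin (s + 1) → R) t =
      (if t 0 = 0 then 0 else 1) * dav l x (Fin.tail t) := by
  simp only [ddav, ← Fin.cons_update, dav_zero_cons]
  rw [dav]; ring

theorem ddav_succ_succ (c : R) (x : Fin s → R) (m l : Fin s) (t : Fin (s + 1) → Fin 2) :
    ddav m.succ l.succ (Fin.cons c x : Fin (s + 1) → R) t =
      (if t 0 = 0 then 1 else c) * ddav m l x (Fin.tail t) := by
  simp only [ddav, ← Fin.cons_update, dav_succ_cons]
  split_ifs <;> ring

/-- glue two multiaffine functions: `(1 - x₀) f₀ + x₀ f₁` -/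
def glue (f₀ f₁ : (Fin s → Fin 2) → R) (t : Fin (s + 1) → Fin 2) : R :=
  if t 0 = 0 then f₀ (Fin.tail t) else f₁ (Fin.tail t) - f₀ (Fin.tail t)

theorem sum_cons (h : (Fin (s + 1) → Fin 2) → R) :
    ∑ t, h t = ∑ t : Fin s → Fin 2, (h (Fin.cons 0 t) + h (Fin.cons 1 t)) := by
  rw [← (Fin.consEquiv (fun _ => Fin 2)).sum_comp, Fintype.sum_prod_type, Fin.sum_univ_two,
    ← Finset.sum_add_distrib]
  rfl

theorem glue_dot (f₀ f₁ : (Fin s → Fin 2) → R) (c d : R) (w : (Fin s → Fin 2) → R)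
    (v : (Fin (s + 1) → Fin 2) → R)
    (hv : ∀ t, v t = (if t 0 = 0 then d else c) * w (Fin.tail t)) :
    glue f₀ f₁ ⬝ᵥ v = (d - c) * (f₀ ⬝ᵥ w) + c * (f₁ ⬝ᵥ w) := by
  simp only [dotProduct, sum_cons, Finset.mul_sum, ← Finset.sum_add_distrib, hv]
  refine Finset.sum_congr rfl fun t _ => ?_
  simp [glue]
  ring

theorem glue_av (f₀ f₁ : (Fin s → Fin 2) → R) (c : R) (x : Fin s → R) :
    glue f₀ f₁ ⬝ᵥ av (Fin.cons c x : Fin (s + 1) → R) =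
      (1 - c) * (f₀ ⬝ᵥ av x) + c * (f₁ ⬝ᵥ av x) :=
  glue_dot _ _ c 1 _ _ (av_cons c x)

theorem glue_dav_zero (f₀ f₁ : (Fin s → Fin 2) → R) (c : R) (x : Fin s → R) :
    glue f₀ f₁ ⬝ᵥ dav 0 (Fin.cons c x : Fin (s + 1) → R) =
      f₁ ⬝ᵥ av x - (f₀ ⬝ᵥ av x) := by
  rw [glue_dot _ _ 1 0 _ _ (dav_zero_cons c x)]; ring

theorem glue_dav_succ (f₀ f₁ : (Fin s → Fin 2) → R) (c : R) (x : Fin s → R) (l) :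
    glue f₀ f₁ ⬝ᵥ dav l.succ (Fin.cons c x : Fin (s + 1) → R) =
      (1 - c) * (f₀ ⬝ᵥ dav l x) + c * (f₁ ⬝ᵥ dav l x) :=
  glue_dot _ _ c 1 _ _ (dav_succ_cons c x l)

theorem glue_ddav_zero_zero (f₀ f₁ : (Fin s → Fin 2) → R) (c : R) (x : Fin s → R) :
    glue f₀ f₁ ⬝ᵥ ddav 0 0 (Fin.cons c x : Fin (s + 1) → R) = 0 := by
  simp [dotProduct, ddav_zero_zero]

theorem glue_ddav_zero_succ (f₀ f₁ : (Fin s → Fin 2) → R) (c : R) (x : Fin s → R) (l) :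
    glue f₀ f₁ ⬝ᵥ ddav 0 l.succ (Fin.cons c x : Fin (s + 1) → R) =
      f₁ ⬝ᵥ dav l x - (f₀ ⬝ᵥ dav l x) := by
  rw [glue_dot _ _ 1 0 _ _ (ddav_zero_succ c x l)]; ring

theorem glue_ddav_succ_zero (f₀ f₁ : (Fin s → Fin 2) → R) (c : R) (x : Fin s → R) (l) :
    glue f₀ f₁ ⬝ᵥ ddav l.succ 0 (Fin.cons c x : Fin (s + 1) → R) =
      f₁ ⬝ᵥ dav l x - (f₀ ⬝ᵥ dav l x) := by
  rw [glue_dot _ _ 1 0 _ _ (ddav_succ_zero c x l)]; ring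

theorem glue_ddav_succ_succ (f₀ f₁ : (Fin s → Fin 2) → R) (c : R) (x : Fin s → R) (m l) :
    glue f₀ f₁ ⬝ᵥ ddav m.succ l.succ (Fin.cons c x : Fin (s + 1) → R) =
      (1 - c) * (f₀ ⬝ᵥ ddav m l x) + c * (f₁ ⬝ᵥ ddav m l x) :=
  glue_dot _ _ c 1 _ _ (ddav_succ_succ c x m l)

/-- a nonzero multiaffine function does not vanish identically -/
theorem exists_dot_av_ne {f : (Fin s → Fin 2) → R} (hf : f ≠ 0) : ∃ x : Fin s → R, f ⬝ᵥ av x ≠ 0 := by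
  induction s with
  | zero =>
    refine ⟨0, fun h => hf ?_⟩
    ext t
    have h' : f ⬝ᵥ av 0 = f t := by
      simp only [dotProduct, av, Finset.univ_unique, Finset.sum_singleton, Finset.univ_eq_empty,
        Finset.prod_empty, mul_one]
      exact congrArg f (Subsingleton.elim _ _)
    rw [← h', h]; rfl
  | succ s ih =>
    have key : glue (fun t => f (Fin.cons 0 t)) (fun t => f (Fin.cons 1 t) + f (Fin.cons 0 t)) = f := by
      ext t
      obtain ⟨e, t, rfl⟩ : ∃ e t', t = Fin.cons e t' := ⟨t 0, Fin.tail t, (Fin.cons_self_tail t).symm⟩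
      fin_cases e <;> simp [glue]
    by_cases h0 : (fun t => f (Fin.cons 0 t)) = 0
    · have h1 : (fun t => f (Fin.cons 1 t) + f (Fin.cons 0 t)) ≠ 0 := by
        intro h1
        apply hf
        rw [← key, h0, h1]; ext t; simp [glue]
      obtain ⟨x, hx⟩ := ih h1
      refine ⟨Fin.cons 1 x, ?_⟩
      rw [← key, glue_av]; simpa using hx
    · obtain ⟨x, hx⟩ := ih h0
      refine ⟨Fin.cons 0 x, ?_⟩
      rw [← key, glue_av]; simpa using hx

end basics

/-- Openness of surjectivity of a matrix with polynomial entries. -/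
theorem surj_open {K : Type u} [Field K] {σ c ι : Type*} [Fintype c] [Fintype ι]
    (M : c → ι → MvPolynomial σ K) (y₀ : σ → K)
    (h : ∀ b : c → K, ∃ f : ι → K, ∀ j, ∑ i, MvPolynomial.aeval y₀ (M j i) * f i = b j) :
    ∃ G : MvPolynomial σ K, MvPolynomial.aeval y₀ G ≠ 0 ∧
      ∀ (L : Type u) [Field L] [Algebra K L] (y : σ → L), MvPolynomial.aeval y G ≠ 0 →
        ∀ b : c → L, ∃ f : ι → L, ∀ j, ∑ i, MvPolynomial.aeval y (M j i) * f i = b j := by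
  classical
  choose N hN using fun j : c => h (Pi.single j 1)
  let Q : Matrix c c (MvPolynomial σ K) :=
    Matrix.of fun j j' => ∑ i, M j i * MvPolynomial.C (N j' i)
  have hQ : ∀ (L : Type u) [Field L] [Algebra K L] (y : σ → L),
      MvPolynomial.aeval y Q.det =
        (Matrix.of fun j j' => ∑ i, MvPolynomial.aeval y (M j i) * algebraMap K L (N j' i)).det := by
    intro L _ _ y
    rw [AlgHom.map_det]
    congr 1
    ext j j'
    simp [Q]
  refine ⟨Q.det, ?_, ?_⟩
  · rw [hQ]
    have : (Matrix.of fun j j' => ∑ i, MvPolynomial.aeval y₀ (M j i) * algebraMap K K (N j' i))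
        = (1 : Matrix c c K) := by
      ext j j'
      rw [Matrix.of_apply]
      have := hN j' j
      simp only [Algebra.algebraMap_self, RingHom.id_apply]
      rw [this, Matrix.one_apply, Pi.single_apply]
    rw [this]; simp
  · intro L _ _ y hy b
    rw [hQ] at hy
    set P : Matrix c c L :=
      Matrix.of fun j j' => ∑ i, MvPolynomial.aeval y (M j i) * algebraMap K L (N j' i) with hP
    refine ⟨fun i => ∑ j', algebraMap K L (N j' i) * (P⁻¹.mulVec b) j', fun j => ?_⟩
    have h1 : P.mulVec (P⁻¹.mulVec b) = b := by
      rw [Matrix.mulVec_mulVec, Matrix.mul_nonsing_inv _ (Ne.isUnit hy), Matrix.one_mulVec]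
    have h2 := congrFun h1 j
    rw [Matrix.mulVec, dotProduct] at h2
    rw [← h2]
    simp only [hP, Matrix.of_apply, Finset.mul_sum, Finset.sum_mul]
    rw [Finset.sum_comm]
    refine Finset.sum_congr rfl fun _ _ => Finset.sum_congr rfl fun _ _ => by ring

/-- Values at all the points, together with gradients at the points of `D`, can be prescribed. -/
def SurD {R : Type*} [CommRing R] {s : ℕ} {α : Type*} (y : α → Fin s → R) (D : Set α) : Prop :=
  ∀ (v : α → R) (g : α → Fin s → R), ∃ f : (Fin s → Fin 2) → R,
    (∀ a, f ⬝ᵥ av (y a) = v a) ∧ ∀ a ∈ D, ∀ l, f ⬝ᵥ dav l (y a) = g a l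

theorem SurD.mono {R : Type*} [CommRing R] {s : ℕ} {α : Type*} {y : α → Fin s → R} {D E : Set α}
    (h : SurD y E) (hDE : D ⊆ E) : SurD y D := fun v g =>
  let ⟨f, h1, h2⟩ := h v g
  ⟨f, h1, fun a ha l => h2 a (hDE ha) l⟩

theorem surD_open {K : Type u} [Field K] {s : ℕ} {α : Type} [Fintype α]
    (D : Set α) (y₀ : α → Fin s → K) (h : SurD y₀ D) :
    ∃ G : MvPolynomial (α × Fin s) K, G ≠ 0 ∧
      ∀ (L : Type u) [Field L] [Algebra K L] (y : α → Fin s → L),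
        MvPolynomial.aeval (fun p : α × Fin s => y p.1 p.2) G ≠ 0 → SurD y D := by
  classical
  let M : (α ⊕ (D × Fin s)) → (Fin s → Fin 2) → (MvPolynomial (α × Fin s) K) := fun c =>
    match c with
    | .inl a => av (fun l => MvPolynomial.X (a, l))
    | .inr (a, l) => dav l (fun l => MvPolynomial.X (a.1, l))
  have e1 : ∀ (L : Type u) [Field L] [Algebra K L] (y : α → Fin s → L)
      (f : (Fin s → Fin 2) → L) (a : α),
      ∑ t, MvPolynomial.aeval (fun p : α × Fin s => y p.1 p.2) (M (.inl a) t) * f t =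
        f ⬝ᵥ av (y a) := by
    intro L _ _ y f a
    refine Finset.sum_congr rfl fun t _ => ?_
    simp only [M]
    rw [← AlgHom.coe_toRingHom, map_av, mul_comm]; simp
  have e2 : ∀ (L : Type u) [Field L] [Algebra K L] (y : α → Fin s → L)
      (f : (Fin s → Fin 2) → L) (a : D) (l),
      ∑ t, MvPolynomial.aeval (fun p : α × Fin s => y p.1 p.2) (M (.inr (a, l)) t) * f t =
        f ⬝ᵥ dav l (y a.1) := by
    intro L _ _ y f a l
    refine Finset.sum_congr rfl fun t _ => ?_
    simp only [M]
    rw [← AlgHom.coe_toRingHom, map_dav, mul_comm]; simp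
  obtain ⟨G, hG, hG'⟩ := surj_open M (fun p => y₀ p.1 p.2) (by
    intro b
    obtain ⟨f, h1, h2⟩ := h (fun a => b (.inl a))
      (fun a l => if ha : a ∈ D then b (.inr (⟨a, ha⟩, l)) else 0)
    refine ⟨f, ?_⟩
    rintro (a | ⟨⟨a, ha⟩, l⟩)
    · rw [e1, h1]
    · rw [e2, h2 a ha l, dif_pos ha])
  refine ⟨G, fun h0 => hG (by simp [h0]), fun L _ _ y hy v g => ?_⟩
  obtain ⟨f, hf⟩ := hG' L _ hy (fun c => match c with
    | .inl a => v a
    | .inr (a, l) => g a.1 l)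
  refine ⟨f, fun a => ?_, fun a ha l => ?_⟩
  · have := hf (.inl a); rw [e1] at this; exact this
  · have := hf (.inr (⟨a, ha⟩, l)); rw [e2] at this; exact this

/-- Hessian condition at the `i`-th point. -/
def HessC {R : Type*} [CommRing R] {s : ℕ} {α : Type*} (y : α → Fin s → R) (i : α) : Prop :=
  ∀ m₀ : Fin s, ∃ F : Fin s → (Fin s → Fin 2) → R,
    (∀ l a, F l ⬝ᵥ av (y a) = 0) ∧ (∀ l a l', F l ⬝ᵥ dav l' (y a) = 0) ∧
    ∀ m, ∑ l, F l ⬝ᵥ ddav m l (y i) = if m = m₀ then 1 else 0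

theorem hess_open {K : Type u} [Field K] {s : ℕ} {α : Type} [Fintype α]
    (y₀ : α → Fin s → K) (h : SurD y₀ Set.univ) (i : α) (hi : HessC y₀ i) :
    ∃ G : MvPolynomial (α × Fin s) K, G ≠ 0 ∧
      ∀ (L : Type u) [Field L] [Algebra K L] (y : α → Fin s → L),
        MvPolynomial.aeval (fun p : α × Fin s => y p.1 p.2) G ≠ 0 → HessC y i := by
  classical
  let M : ((Fin s × α) ⊕ ((Fin s × α × Fin s) ⊕ Fin s)) → (Fin s × (Fin s → Fin 2)) →
      (MvPolynomial (α × Fin s) K) := fun c p =>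
    match c with
    | .inl (l, a) => if p.1 = l then av (fun l => MvPolynomial.X (a, l)) p.2 else 0
    | .inr (.inl (l, a, l')) => if p.1 = l then dav l' (fun l => MvPolynomial.X (a, l)) p.2 else 0
    | .inr (.inr m) => ddav m p.1 (fun l => MvPolynomial.X (i, l)) p.2
  have e1 : ∀ (L : Type u) [Field L] [Algebra K L] (y : α → Fin s → L)
      (F : Fin s × (Fin s → Fin 2) → L) (l a),
      ∑ t, MvPolynomial.aeval (fun p : α × Fin s => y p.1 p.2) (M (.inl (l, a)) t) * F t =
        (fun t => F (l, t)) ⬝ᵥ av (y a) := by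
    intro L _ _ y F l a
    simp only [dotProduct, M, Fintype.sum_prod_type]
    rw [Finset.sum_eq_single l]
    · refine Finset.sum_congr rfl fun t _ => ?_
      rw [if_pos rfl, ← AlgHom.coe_toRingHom, map_av, mul_comm]; simp
    · intro l' _ hl'; simp [hl']
    · simp
  have e2 : ∀ (L : Type u) [Field L] [Algebra K L] (y : α → Fin s → L)
      (F : Fin s × (Fin s → Fin 2) → L) (l a l'),
      ∑ t, MvPolynomial.aeval (fun p : α × Fin s => y p.1 p.2) (M (.inr (.inl (l, a, l'))) t) * F t =
        (fun t => F (l, t)) ⬝ᵥ dav l' (y a) := by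
    intro L _ _ y F l a l'
    simp only [dotProduct, M, Fintype.sum_prod_type]
    rw [Finset.sum_eq_single l]
    · refine Finset.sum_congr rfl fun t _ => ?_
      rw [if_pos rfl, ← AlgHom.coe_toRingHom, map_dav, mul_comm]; simp
    · intro l' _ hl'; simp [hl']
    · simp
  have e3 : ∀ (L : Type u) [Field L] [Algebra K L] (y : α → Fin s → L)
      (F : Fin s × (Fin s → Fin 2) → L) (m),
      ∑ t, MvPolynomial.aeval (fun p : α × Fin s => y p.1 p.2) (M (.inr (.inr m)) t) * F t =
        ∑ l, (fun t => F (l, t)) ⬝ᵥ ddav m l (y i) := by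
    intro L _ _ y F m
    simp only [dotProduct, M, Fintype.sum_prod_type]
    refine Finset.sum_congr rfl fun l _ => Finset.sum_congr rfl fun t _ => ?_
    rw [← AlgHom.coe_toRingHom, map_ddav, mul_comm]; simp
  obtain ⟨G, hG, hG'⟩ := surj_open M (fun p => y₀ p.1 p.2) (by
    intro b
    choose f h1 h2 using fun l : Fin s => h (fun a => b (.inl (l, a)))
      (fun a l' => b (.inr (.inl (l, a, l'))))
    choose F hF1 hF2 hF3 using hi
    let c : Fin s → K := fun m => b (.inr (.inr m)) - ∑ l, f l ⬝ᵥ ddav m l (y₀ i)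
    refine ⟨fun p => f p.1 p.2 + ∑ m₀, c m₀ * F m₀ p.1 p.2, ?_⟩
    have key : ∀ l (v : (Fin s → Fin 2) → K), (fun t => f l t + ∑ m₀, c m₀ * F m₀ l t) ⬝ᵥ v =
        f l ⬝ᵥ v + ∑ m₀, c m₀ * (F m₀ l ⬝ᵥ v) := by
      intro l v
      simp only [dotProduct, add_mul, Finset.sum_add_distrib, Finset.sum_mul, Finset.mul_sum]
      rw [Finset.sum_comm]
      simp only [mul_assoc]
    rintro (⟨l, a⟩ | ⟨l, a, l'⟩ | m)
    · rw [e1]; simp only; rw [key]; simp [h1, hF1]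
    · rw [e2]; simp only; rw [key]; simp [h2, hF2]
    · rw [e3]; simp only; simp_rw [key]
      rw [Finset.sum_add_distrib, Finset.sum_comm]
      simp_rw [← Finset.mul_sum, hF3]
      simp [c])
  refine ⟨G, fun h0 => hG (by simp [h0]), fun L _ _ y hy m₀ => ?_⟩
  obtain ⟨F, hF⟩ := hG' L _ hy (fun c => match c with
    | .inl _ => 0
    | .inr (.inl _) => 0
    | .inr (.inr m) => if m = m₀ then 1 else 0)
  refine ⟨fun l t => F (l, t), fun l a => ?_, fun l a l' => ?_, fun m => ?_⟩
  · have := hF (.inl (l, a)); rw [e1] at this; exact this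
  · have := hF (.inr (.inl (l, a, l'))); rw [e2] at this; exact this
  · have := hF (.inr (.inr m)); rw [e3] at this; exact this

section exist
variable {K : Type u} [Field K]

theorem exists_eval_ne [Infinite K] {σ : Type*} {G : MvPolynomial σ K} (h : G ≠ 0) :
    ∃ x : σ → K, MvPolynomial.aeval x G ≠ 0 := by
  by_contra! hc
  refine h (MvPolynomial.funext fun x => ?_)
  have := hc x
  rw [MvPolynomial.aeval_eq_eval] at this
  simpa using this

theorem surD_common [Infinite K] {s : ℕ} {α : Type} [Fintype α] {J : Type*} [Fintype J] (D : J → Set α)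
    (h : ∀ j, ∃ y : α → Fin s → K, SurD y (D j)) :
    ∃ y : α → Fin s → K, ∀ j, SurD y (D j) := by
  choose y0 hy0 using h
  choose G hG hG' using fun j => surD_open (D j) (y0 j) (hy0 j)
  obtain ⟨x, hx⟩ := exists_eval_ne (Finset.prod_ne_zero_iff.2 fun j (_ : j ∈ univ) => hG j)
  rw [map_prod, Finset.prod_ne_zero_iff] at hx
  exact ⟨fun a l => x (a, l), fun j => hG' j K _ (hx j (mem_univ j))⟩

/-- relative version of `SurD` -/
def SurA {s : ℕ} {α : Type*} (y : α → Fin s → K) (A D : Finset α) : Prop :=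
  ∀ (v : α → K) (g : α → Fin s → K), ∃ f : (Fin s → Fin 2) → K,
    (∀ a ∈ A, f ⬝ᵥ av (y a) = v a) ∧ ∀ a ∈ D, ∀ l, f ⬝ᵥ dav l (y a) = g a l

theorem surA_insert {s : ℕ} {α : Type*} [DecidableEq α] (y : α → Fin s → K) (A D : Finset α)
    (hDA : D ⊆ A) (h : SurA y A D) (hc : D.card * s + A.card < 2 ^ s) (a : α) (ha : a ∉ A) :
    ∃ x, SurA (update y a x) (insert a A) D := by
  let Φ : ((Fin s → Fin 2) → K) →ₗ[K] (A → K) × (D → Fin s → K) :=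
    { toFun := fun f => (fun b => f ⬝ᵥ av (y b), fun b l => f ⬝ᵥ dav l (y b))
      map_add' := by intro f g; ext <;> simp [add_dotProduct]
      map_smul' := by intro c f; ext <;> simp [smul_dotProduct] }
  have hker : LinearMap.ker Φ ≠ ⊥ := by
    apply LinearMap.ker_ne_bot_of_finrank_lt
    simp only [Module.finrank_prod, Module.finrank_pi, Module.finrank_pi_fintype, Fintype.card_coe,
      Fintype.card_fin, Finset.sum_const, Finset.card_univ, Fintype.card_pi, Finset.prod_const,
      smul_eq_mul]
    omega
  obtain ⟨f0, hf0, hne⟩ := Submodule.exists_mem_ne_zero_of_ne_bot hker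
  obtain ⟨x, hx⟩ := exists_dot_av_ne hne
  have h1 : ∀ b ∈ A, f0 ⬝ᵥ av (y b) = 0 := fun b hb => congrFun (congrArg Prod.fst hf0) ⟨b, hb⟩
  have h2 : ∀ b ∈ D, ∀ l, f0 ⬝ᵥ dav l (y b) = 0 := fun b hb l =>
    congrFun (congrFun (congrArg Prod.snd hf0) ⟨b, hb⟩) l
  refine ⟨x, fun v g => ?_⟩
  obtain ⟨f, hf1, hf2⟩ := h v g
  have hA : ∀ b ∈ A, b ≠ a := fun b hb hba => ha (hba ▸ hb)
  refine ⟨f + ((v a - f ⬝ᵥ av x) / (f0 ⬝ᵥ av x)) • f0, fun b hb => ?_, fun b hb l => ?_⟩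
  · rw [add_dotProduct, smul_dotProduct]
    rcases Finset.mem_insert.1 hb with rfl | hb
    · rw [update_self, smul_eq_mul, div_mul_cancel₀ _ hx]; ring
    · rw [update_of_ne (hA b hb), h1 b hb, hf1 b hb]; simp
  · rw [add_dotProduct, smul_dotProduct, update_of_ne (hA b (hDA hb)), h2 b hb, hf2 b hb]; simp

theorem surA_extend {s : ℕ} {α : Type*} [DecidableEq α] (D B : Finset α) (hBD : Disjoint D B)
    (hc : D.card * s + (D.card + B.card) ≤ 2 ^ s) (h : ∃ y : α → Fin s → K, SurA y D D) :
    ∃ y : α → Fin s → K, SurA y (D ∪ B) D := by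
  induction B using Finset.induction_on with
  | empty => simpa using h
  | insert b B hb ih =>
    rw [Finset.card_insert_of_notMem hb] at hc
    rw [Finset.disjoint_insert_right] at hBD
    obtain ⟨y, hy⟩ := ih hBD.2 (by omega)
    have hbn : b ∉ D ∪ B := by simp [hb, hBD.1]
    have hcu := Finset.card_union_le D B
    obtain ⟨x, hx⟩ := surA_insert y (D ∪ B) D Finset.subset_union_left hy (by omega) b hbn
    exact ⟨_, by rw [Finset.union_insert]; exact hx⟩

theorem surD_of_univ {s : ℕ} {α : Type} [Fintype α] [DecidableEq α] (D : Finset α)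
    (h : ∃ y : Fin D.card → Fin s → K, SurD y Set.univ)
    (hc : D.card * s + Fintype.card α ≤ 2 ^ s) :
    ∃ y : α → Fin s → K, SurD y (D : Set α) := by
  obtain ⟨y, hy⟩ := h
  have h0 : ∃ y : α → Fin s → K, SurA y D D := by
    refine ⟨fun a => if ha : a ∈ D then y (D.equivFin ⟨a, ha⟩) else 0, fun v g => ?_⟩
    obtain ⟨f, h1, h2⟩ := hy (fun i => v (D.equivFin.symm i)) (fun i => g (D.equivFin.symm i))
    refine ⟨f, fun a ha => ?_, fun a ha l => ?_⟩
    · simp only [dif_pos ha]; rw [h1]; simp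
    · simp only [dif_pos ha]; rw [h2 _ (Set.mem_univ _)]; simp
  obtain ⟨z, hz⟩ := surA_extend D Dᶜ disjoint_compl_right
    (by rw [Finset.card_add_card_compl]; exact hc) h0
  refine ⟨z, fun v g => ?_⟩
  obtain ⟨f, h1, h2⟩ := hz v g
  exact ⟨f, fun a => h1 a (by simp), fun a ha => h2 a ha⟩

open Classical in
theorem surD_glue {s : ℕ} {α : Type} (y : α → Fin s → K) (D : Finset α)
    (h1 : SurD y (D : Set α)) (h2 : SurD y ((D : Set α)ᶜ)) :
    SurD (fun a => (Fin.cons (if a ∈ D then 0 else 1) (y a) : Fin (s + 1) → K)) Set.univ := by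
  intro v g
  obtain ⟨f₀, a1, a2⟩ := h1 (fun a => if a ∈ D then v a else v a - g a 0) (fun a l => g a l.succ)
  obtain ⟨f₁, b1, b2⟩ := h2 (fun a => if a ∈ D then v a + g a 0 else v a) (fun a l => g a l.succ)
  refine ⟨glue f₀ f₁, fun a => ?_, fun a _ l => ?_⟩
  · rw [glue_av, a1, b1]
    split_ifs <;> ring
  · refine Fin.cases ?_ (fun l => ?_) l
    · rw [glue_dav_zero, a1, b1]
      split_ifs <;> ring
    · rw [glue_dav_succ]
      by_cases ha : a ∈ D
      · rw [a2 a ha]; simp [ha]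
      · rw [b2 a ha]; simp [ha]

theorem num1 (s d : ℕ) (h : d * (s + 2) + s ≤ 2 ^ (s + 1)) (e : ℕ) (he : 2 * e ≤ d + 1) :
    e * (s + 1) + (s - 1) ≤ 2 ^ s ∧ e * s + d ≤ 2 ^ s := by
  refine ⟨?_, ?_⟩
  · by_cases hs : s < 5
    · interval_cases s <;> norm_num at * <;> omega
    · have h3 : s ^ 2 + s ≤ 2 ^ s := by
        push Not at hs
        clear h
        induction s, hs using Nat.le_induction with
        | base => norm_num
        | succ n hn ih => rw [pow_succ 2 n]; nlinarith
      rw [pow_succ] at h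
      obtain ⟨r, rfl⟩ : ∃ r, s = r + 1 := ⟨s - 1, by omega⟩
      simp only [Nat.add_sub_cancel]
      by_cases hd : 2 * r ≤ d
      · nlinarith
      · push Not at hd
        have : e ≤ r := by omega
        nlinarith
  · rw [pow_succ] at h
    nlinarith

theorem exists_surD [Infinite K] (s : ℕ) : ∀ d : ℕ, d * (s + 1) + (s - 1) ≤ 2 ^ s →
    ∃ y : Fin d → Fin s → K, SurD y Set.univ := by
  induction s with
  | zero =>
    intro d hd
    refine ⟨fun _ => 0, fun v g => ⟨fun _ => if h : 0 < d then v ⟨0, h⟩ else 0, fun a => ?_, fun a _ l => l.elim0⟩⟩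
    have ha : 0 < d := a.pos
    have : a = ⟨0, ha⟩ := by ext; simp at hd; have := a.2; simp; omega
    subst this
    simp [dotProduct, av, ha]
  | succ s ih =>
    intro d hd
    have key : ∀ D : Finset (Fin d), 2 * D.card ≤ d + 1 → ∃ y : Fin d → Fin s → K, SurD y (D : Set (Fin d)) := by
      intro D hD
      obtain ⟨h1, h2⟩ := num1 s d (by simpa using hd) _ hD
      exact surD_of_univ D (ih _ h1) (by simpa using h2)
    obtain ⟨D, hD⟩ := Finset.exists_subset_card_eq (s := (univ : Finset (Fin d))) (n := (d + 1) / 2)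
      (by simp; omega)
    obtain ⟨y, hy⟩ := surD_common (K := K) (s := s) (J := Bool)
      (fun b : Bool => if b then (D : Set (Fin d)) else ((D : Set (Fin d))ᶜ)) (by
        rintro (_ | _)
        · simp only [Bool.false_eq_true, if_false]
          rw [← Finset.coe_compl]
          apply key
          rw [Finset.card_compl, hD.2]; simp; omega
        · simpa using key D (by rw [hD.2]; omega))
    exact ⟨_, surD_glue y D (by simpa using hy true) (by simpa using hy false)⟩

theorem hess_glue {s : ℕ} {α : Type} (c : α → K) (y : α → Fin (s + 1) → K) (p : α)
    (h : ∀ w : Fin (s + 1) → K, ∃ f : (Fin (s + 2) → Fin 2) → K,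
      (∀ a, f ⬝ᵥ av (Fin.cons (c a) (y a) : Fin (s + 2) → K) = 0) ∧
      (∀ a l, f ⬝ᵥ dav l (Fin.cons (c a) (y a) : Fin (s + 2) → K) = 0) ∧
      (∀ l, f ⬝ᵥ ddav 0 (Fin.succ l) (Fin.cons (c p) (y p) : Fin (s + 2) → K) = w l) ∧
      (∀ l, f ⬝ᵥ ddav (Fin.succ l) 0 (Fin.cons (c p) (y p) : Fin (s + 2) → K) = w l) ∧
      (f ⬝ᵥ ddav 0 0 (Fin.cons (c p) (y p) : Fin (s + 2) → K) = 0) ∧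
      (∀ m l, f ⬝ᵥ ddav (Fin.succ m) (Fin.succ l) (Fin.cons (c p) (y p) : Fin (s + 2) → K) = 0)) :
    HessC (fun a => (Fin.cons (c a) (y a) : Fin (s + 2) → K)) p := by
  intro m₀
  refine Fin.cases ?_ (fun j => ?_) m₀
  · obtain ⟨f, h1, h2, h3, h4, h5, h6⟩ := h (Pi.single 0 1)
    refine ⟨fun l => if l = Fin.succ 0 then f else 0, fun l a => ?_, fun l a l' => ?_, fun m => ?_⟩ <;> dsimp only
    · split_ifs <;> simp [h1]
    · split_ifs <;> simp [h2]
    · rw [Finset.sum_eq_single (Fin.succ 0)]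
      · rw [if_pos rfl]
        refine Fin.cases ?_ (fun m => ?_) m
        · rw [h3]; simp
        · rw [h6]; simp
      · intro b _ hb; rw [if_neg hb]; simp
      · simp
  · obtain ⟨f, h1, h2, h3, h4, h5, h6⟩ := h (Pi.single j 1)
    refine ⟨fun l => if l = 0 then f else 0, fun l a => ?_, fun l a l' => ?_, fun m => ?_⟩ <;> dsimp only
    · split_ifs <;> simp [h1]
    · split_ifs <;> simp [h2]
    · rw [Finset.sum_eq_single 0]
      · rw [if_pos rfl]
        refine Fin.cases ?_ (fun m => ?_) m
        · rw [h5]; simp [(Fin.succ_ne_zero j).symm]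
        · rw [h4]; simp [Pi.single_apply]
      · intro b _ hb; rw [if_neg hb]; simp
      · simp

open Classical in
theorem hess_glue' {s : ℕ} {α : Type} (y : α → Fin (s + 1) → K) (D : Finset α) (p : α)
    (h1 : SurD y (insert p (D : Set α))) (h2 : SurD y (insert p (D : Set α)ᶜ)) :
    HessC (fun a => (Fin.cons (if a ∈ D then 0 else 1) (y a) : Fin (s + 2) → K)) p := by
  apply hess_glue
  intro w
  by_cases hp : p ∈ D
  · obtain ⟨f, a1, a2⟩ := h2 0 (fun a => if a = p then w else 0)
    have a3 : ∀ a ∉ D, ∀ l, f ⬝ᵥ dav l (y a) = 0 := by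
      intro a ha l
      rw [a2 a (by simp [ha]), if_neg (by rintro rfl; exact ha hp)]; rfl
    have a4 : ∀ l, f ⬝ᵥ dav l (y p) = w l := by
      intro l; rw [a2 p (by simp), if_pos rfl]
    refine ⟨glue 0 f, fun a => ?_, fun a l => ?_, fun l => ?_, fun l => ?_, ?_, fun m l => ?_⟩
    · rw [glue_av, a1]; simp
    · refine Fin.cases ?_ (fun l => ?_) l
      · rw [glue_dav_zero, a1]; simp
      · rw [glue_dav_succ]
        by_cases ha : a ∈ D
        · simp [ha]
        · rw [a3 a ha]; simp
    · rw [glue_ddav_zero_succ, a4]; simp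
    · rw [glue_ddav_succ_zero, a4]; simp
    · rw [glue_ddav_zero_zero]
    · rw [glue_ddav_succ_succ]; simp [hp]
  · obtain ⟨f, a1, a2⟩ := h1 0 (fun a => if a = p then -w else 0)
    have a3 : ∀ a ∈ D, ∀ l, f ⬝ᵥ dav l (y a) = 0 := by
      intro a ha l
      rw [a2 a (by simp [ha]), if_neg (by rintro rfl; exact hp ha)]; rfl
    have a4 : ∀ l, f ⬝ᵥ dav l (y p) = - w l := by
      intro l; rw [a2 p (by simp), if_pos rfl]; rfl
    refine ⟨glue f 0, fun a => ?_, fun a l => ?_, fun l => ?_, fun l => ?_, ?_, fun m l => ?_⟩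
    · rw [glue_av, a1]; simp
    · refine Fin.cases ?_ (fun l => ?_) l
      · rw [glue_dav_zero, a1]; simp
      · rw [glue_dav_succ]
        by_cases ha : a ∈ D
        · rw [a3 a ha]; simp
        · simp [ha]
    · rw [glue_ddav_zero_succ, a4]; simp
    · rw [glue_ddav_succ_zero, a4]; simp
    · rw [glue_ddav_zero_zero]
    · rw [glue_ddav_succ_succ]; simp [hp]

theorem exists_hess [Infinite K] (s k : ℕ) (hs : 5 ≤ s)
    (hineq : (k + s - 1) * (s + 1) ≤ 2 ^ s - 1) :
    ∃ y : Fin k → Fin s → K, SurD y Set.univ ∧ ∀ i, HessC y i := by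
  obtain ⟨n, rfl⟩ : ∃ n, s = n + 2 := ⟨s - 2, by omega⟩
  have hpos : 1 ≤ 2 ^ (n + 2) := Nat.one_le_two_pow
  have hineq' : (k + (n + 1)) * (n + 3) + 1 ≤ 2 * 2 ^ (n + 1) := by
    have e : k + (n + 2) - 1 = k + (n + 1) := by omega
    rw [e] at hineq
    have e2 : 2 ^ (n + 2) = 2 * 2 ^ (n + 1) := by ring
    have h3 : (k + (n + 1)) * (n + 2 + 1) + 1 ≤ 2 ^ (n + 2) := Nat.add_le_of_le_sub hpos hineq
    rw [e2] at h3
    exact h3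
  clear hineq
  have key : ∀ D : Finset (Fin k), 2 * D.card ≤ k + 3 →
      ∃ y : Fin k → Fin (n + 1) → K, SurD y (D : Set (Fin k)) := by
    intro D hD
    refine surD_of_univ D (exists_surD _ _ ?_) ?_
    · simp only [Nat.add_sub_cancel]
      nlinarith
    · simp only [Fintype.card_fin]
      nlinarith
  obtain ⟨D, -, hD⟩ := Finset.exists_subset_card_eq (s := (univ : Finset (Fin k))) (n := (k + 1) / 2)
      (by simp; omega)
  have hDc : Dᶜ.card = k - (k + 1) / 2 := by rw [Finset.card_compl, hD]; simp
  obtain ⟨y, hy⟩ := surD_common (K := K) (s := n + 1) (J := Bool × Fin k)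
      (fun j => if j.1 then insert j.2 (D : Set (Fin k)) else insert j.2 ((D : Set (Fin k))ᶜ)) (by
        rintro ⟨_ | _, p⟩
        · simp only [Bool.false_eq_true, if_false]
          rw [← Finset.coe_compl, ← Finset.coe_insert]
          apply key
          have := Finset.card_insert_le p Dᶜ
          omega
        · simp only [if_true]
          rw [← Finset.coe_insert]
          apply key
          have := Finset.card_insert_le p D
          omega)
  have g1 : ∀ p, SurD y (insert p (D : Set (Fin k))) := fun p => by simpa using hy (true, p)
  have g2 : ∀ p, SurD y (insert p (D : Set (Fin k))ᶜ) := fun p => by simpa using hy (false, p)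
  classical
  rcases Nat.eq_zero_or_pos k with rfl | hk
  · exact ⟨fun i => i.elim0, fun v g => ⟨0, fun a => a.elim0, fun a => a.elim0⟩, fun i => i.elim0⟩
  refine ⟨_, surD_glue y D ((g1 ⟨0, hk⟩).mono (Set.subset_insert _ _))
    ((g2 ⟨0, hk⟩).mono (Set.subset_insert _ _)), fun i => ?_⟩
  exact hess_glue' y D i (g1 i) (g2 i)

theorem main_gen [Infinite K] (s k : ℕ) (hs : 5 ≤ s)
    (hineq : (k + s - 1) * (s + 1) ≤ 2 ^ s - 1) :
    ∃ G : MvPolynomial (Fin k × Fin s) K, G ≠ 0 ∧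
      ∀ (L : Type u) [Field L] [Algebra K L] (y : Fin k → Fin s → L),
        MvPolynomial.aeval (fun p : Fin k × Fin s => y p.1 p.2) G ≠ 0 →
          SurD y Set.univ ∧ ∀ i, HessC y i := by
  obtain ⟨y, h1, h2⟩ := exists_hess (K := K) s k hs hineq
  obtain ⟨G0, hG0, hG0'⟩ := surD_open _ y h1
  choose G hG hG' using fun i => hess_open y h1 i (h2 i)
  refine ⟨G0 * ∏ i, G i, mul_ne_zero hG0 (Finset.prod_ne_zero_iff.2 fun i _ => hG i), ?_⟩
  intro L _ _ y hy
  rw [map_mul, map_prod] at hy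
  have := Finset.prod_ne_zero_iff.1 (right_ne_zero_of_mul hy)
  exact ⟨hG0' L y (left_ne_zero_of_mul hy), fun i => hG' i L y (this i (mem_univ i))⟩

end exist

section topo
variable {K : Type u} [Field K] {ι : Type}

theorem hom_eval {f : MvPolynomial ι K} {d : ℕ} (hf : f.IsHomogeneous d) (a : K) (v : ι → K) :
    MvPolynomial.eval (a • v) f = a ^ d * MvPolynomial.eval v f := by
  rw [MvPolynomial.eval_eq, MvPolynomial.eval_eq, Finset.mul_sum]
  refine Finset.sum_congr rfl fun e he => ?_
  have h1 := hf (MvPolynomial.mem_support_iff.1 he)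
  have h1 : ∑ i ∈ e.support, e i = d := by
    rw [← h1, Finsupp.weight_apply, Finsupp.sum]; simp
  simp only [Pi.smul_apply, smul_eq_mul, mul_pow, Finset.prod_mul_distrib]
  rw [Finset.prod_pow_eq_pow_sum]
  rw [h1]; ring

/-- a homogeneous polynomial that is nonzero somewhere on a line is nonzero at the representative -/
theorem hom_rep_ne {f : MvPolynomial ι K} {d : ℕ} (hf : f.IsHomogeneous d) (x : PP K ι) (v : ι → K)
    (hv : v ∈ x.submodule) (h : MvPolynomial.eval v f ≠ 0) : MvPolynomial.eval x.rep f ≠ 0 := by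
  rw [Projectivization.submodule_eq, Submodule.mem_span_singleton] at hv
  obtain ⟨a, rfl⟩ := hv
  rw [hom_eval hf] at h
  exact right_ne_zero_of_mul h

theorem rep_mem (x : PP K ι) : x.rep ∈ x.submodule := by
  rw [Projectivization.submodule_eq]; exact Submodule.mem_span_singleton_self _

theorem isZClosed_union {Y Z : Set (PP K ι)} (hY : IsZClosed Y) (hZ : IsZClosed Z) :
    IsZClosed (Y ∪ Z) := by
  obtain ⟨S, hS, rfl⟩ := hY
  obtain ⟨T, hT, rfl⟩ := hZ
  refine ⟨{h | ∃ f ∈ S, ∃ g ∈ T, h = f * g}, ?_, ?_⟩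
  · rintro _ ⟨f, hf, g, hg, rfl⟩
    obtain ⟨d, hd⟩ := hS f hf
    obtain ⟨e, he⟩ := hT g hg
    exact ⟨_, hd.mul he⟩
  · ext x
    constructor
    · rintro (h | h) _ ⟨f, hf, g, hg, rfl⟩ v hv
      · rw [map_mul, h f hf v hv, zero_mul]
      · rw [map_mul, h g hg v hv, mul_zero]
    · intro h
      by_contra hc
      have h1 : ¬ x ∈ zeroLocus S := fun h => hc (Or.inl h)
      have h2 : ¬ x ∈ zeroLocus T := fun h => hc (Or.inr h)
      simp only [zeroLocus, Set.mem_ofPred_eq, not_forall] at h1 h2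
      obtain ⟨f, hf, v, hv, hfv⟩ := h1
      obtain ⟨g, hg, w, hw, hgw⟩ := h2
      obtain ⟨d, hd⟩ := hS f hf
      obtain ⟨e, he⟩ := hT g hg
      have := h (f * g) ⟨f, hf, g, hg, rfl⟩ _ (rep_mem x)
      rw [map_mul] at this
      exact mul_ne_zero (hom_rep_ne hd x v hv hfv) (hom_rep_ne he x w hw hgw) this

theorem isZClosed_empty : IsZClosed (∅ : Set (PP K ι)) := by
  refine ⟨{1}, fun f hf => ⟨0, ?_⟩, ?_⟩
  · rw [Set.mem_singleton_iff.1 hf]; exact MvPolynomial.isHomogeneous_one _ _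
  · ext x
    simp only [Set.mem_empty_iff_false, false_iff]
    intro h
    simpa using h 1 rfl 0 (Submodule.zero_mem _)

theorem eq_of_minors (x y : PP K ι) (h : ∀ i j, x.rep i * y.rep j = x.rep j * y.rep i) : x = y := by
  obtain ⟨j, hj⟩ : ∃ j, y.rep j ≠ 0 := by
    by_contra! hc; exact y.rep_nonzero (funext hc)
  rw [← x.mk_rep, ← y.mk_rep, Projectivization.mk_eq_mk_iff']
  refine ⟨x.rep j / y.rep j, ?_⟩
  ext i
  simp only [Pi.smul_apply, smul_eq_mul]
  rw [div_mul_eq_mul_div, div_eq_iff hj]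
  exact (h i j).symm

theorem isZClosed_singleton (y : PP K ι) : IsZClosed ({y} : Set (PP K ι)) := by
  refine ⟨{f | ∃ i j, f = MvPolynomial.C (y.rep j) * MvPolynomial.X i -
      MvPolynomial.C (y.rep i) * MvPolynomial.X j}, ?_, ?_⟩
  · rintro _ ⟨i, j, rfl⟩
    refine ⟨1, MvPolynomial.IsHomogeneous.sub ?_ ?_⟩
    · simpa using (MvPolynomial.isHomogeneous_C ι (y.rep j)).mul (MvPolynomial.isHomogeneous_X K i)
    · simpa using (MvPolynomial.isHomogeneous_C ι (y.rep i)).mul (MvPolynomial.isHomogeneous_X K j)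
  · ext x
    simp only [Set.mem_singleton_iff]
    constructor
    · rintro rfl _ ⟨i, j, rfl⟩ v hv
      rw [Projectivization.submodule_eq, Submodule.mem_span_singleton] at hv
      obtain ⟨a, rfl⟩ := hv
      simp; ring
    · intro h
      apply eq_of_minors
      intro i j
      have := h _ ⟨i, j, rfl⟩ _ (rep_mem x)
      simp at this
      linear_combination this

theorem isZClosed_finite {S : Set (PP K ι)} (hS : S.Finite) : IsZClosed S := by
  induction S, hS using Set.Finite.induction_on with
  | empty => exact isZClosed_empty
  | insert _ _ ih => exact isZClosed_union (isZClosed_singleton _) ih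

theorem subset_zclosure (S : Set (PP K ι)) : S ⊆ zclosure S := Set.subset_sInter fun _ h => h.2

theorem zclosure_min {S Y : Set (PP K ι)} (h : S ⊆ Y) (hY : IsZClosed Y) : zclosure S ⊆ Y :=
  Set.sInter_subset_of_mem ⟨hY, h⟩

theorem zdim_finite {S A : Set (PP K ι)} (hA : A.Finite) (h : S ⊆ A) : zdim S ≤ 0 := by
  have hirr : ∀ Y : Set (PP K ι), IsZIrreducible Y → Y ⊆ A → ∀ a ∈ Y, Y ⊆ {a} := by
    intro Y hY hYA a ha
    rcases hY.2 {a} (A \ {a}) (isZClosed_singleton a) (isZClosed_finite (hA.subset Set.sdiff_subset))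
      (fun y hy => by
        by_cases hya : y = a
        · exact Or.inl hya
        · exact Or.inr ⟨hYA hy, hya⟩) with h | h
    · exact h
    · exact absurd rfl (h ha).2
  unfold zdim
  rw [Order.krullDim_nonpos_iff_forall_isMax]
  rintro ⟨Y, hY1, hY2, hY3⟩ ⟨Z, hZ1, hZ2, hZ3⟩ hYZ
  change Y ⊆ Z at hYZ
  change Z ⊆ Y
  have hc := zclosure_min h (isZClosed_finite hA)
  obtain ⟨a, ha⟩ := hY2.1
  have := hirr Z hZ2 (hZ3.trans hc) a (hYZ ha)
  intro z hz
  rw [Set.mem_singleton_iff.1 (this hz)]; exact ha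

end topo

/-- chain rule for a derivation -/
theorem deriv_aeval {K A M σ : Type*} [CommRing K] [CommRing A] [Algebra K A] [AddCommGroup M]
    [Module K M] [Module A M] [IsScalarTower K A M]
    [Fintype σ] (D : Derivation K A M) (x : σ → A) (f : MvPolynomial σ K) :
    D (MvPolynomial.aeval x f) = ∑ i, MvPolynomial.aeval x (MvPolynomial.pderiv i f) • D (x i) := by
  classical
  induction f using MvPolynomial.induction_on with
  | C a => simp
  | add p q hp hq => simp [hp, hq, add_smul, Finset.sum_add_distrib]
  | mul_X p i hp =>
    rw [map_mul, Derivation.leibniz, hp, MvPolynomial.aeval_X]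
    simp only [Derivation.leibniz, map_add, smul_eq_mul, map_mul, MvPolynomial.aeval_X,
      MvPolynomial.pderiv_X, add_smul, Finset.sum_add_distrib]
    congr 1
    · rw [Finset.sum_eq_single i]
      · simp
      · intro j _ hj; simp [Ne.symm hj]
      · simp
    · rw [Finset.smul_sum]
      simp only [mul_smul]

section seg
variable {s : ℕ}

section ring
variable {R : Type*} [CommRing R]

/-- coordinate unit index -/
def E1 (l : Fin s) : Fin s → Fin 2 := Pi.single l 1

theorem av_zero (x : Fin s → R) : av x 0 = 1 := by simp [av]

theorem av_rec (x : Fin s → R) (l : Fin s) (t : Fin s → Fin 2) (ht : t l ≠ 0) :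
    av x t = x l * av x (update t l 0) := by
  have h1 := av_update x l (x l) t
  have h2 := av_update x l (x l) (update t l 0)
  rw [update_eq_self] at h1 h2
  rw [h1, h2, if_neg ht, update_self, if_pos rfl, one_mul]
  congr 1
  refine Finset.prod_congr rfl fun j hj => ?_
  rw [update_of_ne (Finset.ne_of_mem_erase hj)]

theorem av_E1 (x : Fin s → R) (l : Fin s) : av x (E1 l) = x l := by
  rw [av_rec x l _ (by simp [E1])]
  have : update (E1 l) l 0 = (0 : Fin s → Fin 2) := by
    unfold E1; ext j; by_cases h : j = l
    · subst h; simp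
    · simp [h]
  rw [this, av_zero, mul_one]

theorem dav_rec_self (x : Fin s → R) (l : Fin s) (t : Fin s → Fin 2) (ht : t l ≠ 0) :
    dav l x t = av x (update t l 0) := by
  have h2 := av_update x l (x l) (update t l 0)
  rw [update_eq_self] at h2
  rw [dav_eq, h2, if_neg ht, update_self, if_pos rfl, one_mul, one_mul]
  refine Finset.prod_congr rfl fun j hj => ?_
  rw [update_of_ne (Finset.ne_of_mem_erase hj)]

theorem dav_of_zero (x : Fin s → R) (l : Fin s) (t : Fin s → Fin 2) (ht : t l = 0) :
    dav l x t = 0 := by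
  rw [dav_eq, if_pos ht, zero_mul]

theorem dav_rec (x : Fin s → R) (m l : Fin s) (hml : m ≠ l) (t : Fin s → Fin 2) (ht : t l ≠ 0) :
    dav m x t = x l * dav m x (update t l 0) := by
  unfold dav
  rw [av_rec _ l t ht, av_rec (update x m 0) l t ht, update_of_ne hml.symm, update_of_ne hml.symm]
  ring

theorem dav_E1 (x : Fin s → R) (m l : Fin s) : dav m x (E1 l) = if m = l then 1 else 0 := by
  split_ifs with h
  · subst h
    rw [dav_rec_self _ _ _ (by simp [E1])]
    have : update (E1 m) m 0 = (0 : Fin s → Fin 2) := by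
      unfold E1; ext j; by_cases h : j = m
      · subst h; simp
      · simp [h]
    rw [this, av_zero]
  · exact dav_of_zero _ _ _ (by simp [E1, h])

/-- the tangency recursion determines a vector -/
theorem tangent_rec (x : Fin s → R) (w : (Fin s → Fin 2) → R)
    (hw : ∀ l t, t l ≠ 0 → w t + w 0 * av x t = w (update t l 0) * x l + w (E1 l) * av x (update t l 0))
    (t : Fin s → Fin 2) :
    w t = w 0 * av x t + ∑ m, (w (E1 m) - x m * w 0) * dav m x t := by
  induction hn : (univ.filter fun l => t l ≠ 0).card generalizing t with
  | zero =>
    have : t = 0 := by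
      ext l
      rw [Finset.card_eq_zero, Finset.filter_eq_empty_iff] at hn
      have := hn (mem_univ l)
      simp at this
      simp [this]
    subst this
    rw [av_zero, Finset.sum_eq_zero]
    · ring
    · intro m _; rw [dav_of_zero _ _ _ rfl, mul_zero]
  | succ n ih =>
    obtain ⟨l, hl⟩ : ∃ l, l ∈ univ.filter fun l => t l ≠ 0 := by
      rw [← Finset.Nonempty, ← Finset.card_pos]; omega
    have htl : t l ≠ 0 := (Finset.mem_filter.1 hl).2
    have h1 := ih (update t l 0) (by
      have : (univ.filter fun j => update t l 0 j ≠ 0) = (univ.filter fun j => t j ≠ 0).erase l := by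
        ext j
        by_cases h : j = l
        · subst h; simp
        · simp [h]
      rw [this, Finset.card_erase_of_mem hl, hn]; simp)
    have h2 := hw l t htl
    rw [h1] at h2
    have h3 : ∑ m, (w (E1 m) - x m * w 0) * dav m x t =
        (w (E1 l) - x l * w 0) * av x (update t l 0) +
          x l * ∑ m, (w (E1 m) - x m * w 0) * dav m x (update t l 0) := by
      rw [← Finset.add_sum_erase _ _ (mem_univ l), ← Finset.add_sum_erase univ
        (fun m => (w (E1 m) - x m * w 0) * dav m x (update t l 0)) (mem_univ l), dav_rec_self _ _ _ htl,
        dav_of_zero x l (update t l 0) (by simp), mul_zero, zero_add, Finset.mul_sum]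
      congr 1
      refine Finset.sum_congr rfl fun m hm => ?_
      rw [dav_rec _ _ _ (Finset.ne_of_mem_erase hm) _ htl]; ring
    rw [h3]
    rw [av_rec _ l t htl] at h2 ⊢
    linear_combination h2

end ring

variable {K : Type u} [Field K]

/-- the Segre variety of lines -/
def segX (K : Type*) [Field K] (s : ℕ) : Set (PP K (Fin s → Fin 2)) :=
  {x | ∃ u : Fin s → Fin 2 → K, x.submodule = Submodule.span K
      ({fun t => ∏ i, u i (t i)} : Set ((Fin s → Fin 2) → K))}

theorem segX_eq : segX K s = segreVariety K s (fun _ => 1) := rfl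

theorem av_ne_zero {R : Type*} [CommRing R] [Nontrivial R] (x : Fin s → R) : av x ≠ 0 := fun h => by
  have := congrFun h 0
  rw [av_zero] at this; exact one_ne_zero this

theorem dav_ne_zero {R : Type*} [CommRing R] [Nontrivial R] (l : Fin s) (x : Fin s → R) :
    dav l x ≠ 0 := fun h => by
  have := congrFun h (E1 l)
  rw [dav_E1, if_pos rfl] at this; exact one_ne_zero this

def pt (x : Fin s → K) : PP K (Fin s → Fin 2) := Projectivization.mk K (av x) (av_ne_zero x)

theorem pt_submodule (x : Fin s → K) : (pt x).submodule = Submodule.span K {av x} :=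
  Projectivization.submodule_mk _ _

theorem av_eq_prod {R : Type*} [CommRing R] (x : Fin s → R) :
    av x = fun t => ∏ i, (fun e : Fin 2 => if e = 0 then 1 else x i) (t i) := rfl

theorem pt_mem (x : Fin s → K) : pt x ∈ segX K s :=
  ⟨fun i e => if e = 0 then 1 else x i, pt_submodule x⟩

theorem smul_av_mem (x : Fin s → K) (c : K) : c • av x ∈ (pt x).submodule := by
  rw [pt_submodule]; exact Submodule.smul_mem _ _ (Submodule.mem_span_singleton_self _)

theorem pt_rep (x : Fin s → K) : ∃ c : K, c ≠ 0 ∧ (pt x).rep = c • av x := by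
  obtain ⟨a, ha⟩ := Projectivization.exists_smul_eq_mk_rep K (av x) (av_ne_zero x)
  exact ⟨a, a.ne_zero, ha.symm⟩

/-- vectors in the cone -/
theorem prod_eq_smul_av {R : Type*} [Field R] (u : Fin s → Fin 2 → R) (h : ∀ i, u i 0 ≠ 0) :
    (fun t => ∏ i, u i (t i)) = (∏ i, u i 0) • av fun i => u i 1 / u i 0 := by
  ext t
  simp only [Pi.smul_apply, smul_eq_mul, av, ← Finset.prod_mul_distrib]
  refine Finset.prod_congr rfl fun i _ => ?_
  generalize t i = e
  have hi := h i
  fin_cases e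
  · simp
  · simp; field_simp

theorem exists_pt_of_rep {x : PP K (Fin s → Fin 2)} (hx : x ∈ segX K s) (h0 : x.rep 0 ≠ 0) :
    ∃ ξ, x = pt ξ := by
  obtain ⟨u, hu⟩ := hx
  have h1 : x.rep ∈ x.submodule := rep_mem x
  rw [hu, Submodule.mem_span_singleton] at h1
  obtain ⟨c, hc⟩ := h1
  have h2 : ∀ i, u i 0 ≠ 0 := by
    intro i hi
    apply h0
    rw [← hc]
    simp only [Pi.smul_apply, smul_eq_mul, Pi.zero_apply]
    rw [Finset.prod_eq_zero (mem_univ i) hi, mul_zero]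
  refine ⟨fun i => u i 1 / u i 0, Projectivization.submodule_injective ?_⟩
  rw [hu, pt_submodule, prod_eq_smul_av u h2]
  exact Submodule.span_singleton_smul_eq (Ne.isUnit (Finset.prod_ne_zero_iff.2 fun i _ => h2 i)) _

theorem vanish_av {f : MvPolynomial (Fin s → Fin 2) K} (hf : f ∈ homogVanishingIdeal (segX K s))
    (c : K) (x : Fin s → K) : MvPolynomial.eval (c • av x) f = 0 :=
  hf.2 _ (pt_mem x) _ (smul_av_mem x c)

theorem deriv_vanish [Infinite K] {f : MvPolynomial (Fin s → Fin 2) K}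
    (hf : f ∈ homogVanishingIdeal (segX K s)) (c : K) (x : Fin s → K) (l : Fin s) :
    ∑ t, c * dav l x t * MvPolynomial.eval (c • av x) (MvPolynomial.pderiv t f) = 0 := by
  let z : (Fin s → Fin 2) → Polynomial K := fun t =>
    Polynomial.C (c * av x t) + Polynomial.C (c * dav l x t) * Polynomial.X
  have hz : ∀ (e : K) (g : MvPolynomial (Fin s → Fin 2) K),
      (MvPolynomial.aeval z g).eval e = MvPolynomial.eval (c • av (update x l (x l + e))) g := by
    intro e g
    rw [← Polynomial.coe_evalRingHom, ← MvPolynomial.coe_aeval_eq_eval]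
    change (Polynomial.evalRingHom e) (MvPolynomial.aeval z g) = _
    have : (Polynomial.aeval e : Polynomial K →ₐ[K] K).comp (MvPolynomial.aeval z) =
        MvPolynomial.aeval (c • av (update x l (x l + e))) := by
      apply MvPolynomial.algHom_ext
      intro t
      simp only [AlgHom.comp_apply, MvPolynomial.aeval_X, z]
      have h1 := av_update_sub x l (x l + e) (x l) t
      rw [update_eq_self] at h1
      simp
      linear_combination (-c) * h1
    exact DFunLike.congr_fun this g
  have h0 : MvPolynomial.aeval z f = 0 := by
    apply Polynomial.funext
    intro e
    rw [hz, vanish_av hf]; simp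
  have h1 := deriv_aeval (Polynomial.derivative' : Derivation K (Polynomial K) (Polynomial K)) z f
  rw [h0, map_zero] at h1
  have h2 := congrArg (Polynomial.eval 0) h1
  rw [Polynomial.eval_finsetSum] at h2
  simp only [smul_eq_mul, Polynomial.eval_mul, hz, add_zero, update_eq_self] at h2
  rw [Polynomial.eval_zero] at h2
  rw [h2]
  refine Finset.sum_congr rfl fun t _ => ?_
  simp [z]; ring

theorem dav_mem_tangent [Infinite K] (x : Fin s → K) (l : Fin s) :
    Projectivization.mk K (dav l x) (dav_ne_zero l x) ∈ embTangentSpace (segX K s) (pt x) := by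
  intro f hf
  obtain ⟨c, hc, h1⟩ := pt_rep x
  obtain ⟨a, h2⟩ := Projectivization.exists_smul_eq_mk_rep K (dav l x) (dav_ne_zero l x)
  rw [h1, ← h2]
  have := deriv_vanish hf c x l
  have h3 : ∑ t, c * (dav l x t * MvPolynomial.eval (c • av x) (MvPolynomial.pderiv t f)) = 0 := by
    rw [← this]; exact Finset.sum_congr rfl fun t _ => by ring
  rw [← Finset.mul_sum] at h3
  have h4 := (mul_eq_zero.1 h3).resolve_left hc
  have h5 : ∑ t, (a • dav l x) t * MvPolynomial.eval (c • av x) (MvPolynomial.pderiv t f) =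
    (a : K) * ∑ t, dav l x t * MvPolynomial.eval (c • av x) (MvPolynomial.pderiv t f) := by
    rw [Finset.mul_sum]; exact Finset.sum_congr rfl fun t _ => by
      rw [Pi.smul_apply, Units.smul_def, smul_eq_mul]; ring
  rw [h5, h4, mul_zero]

theorem quadric_mem (l : Fin s) (t : Fin s → Fin 2) (ht : t l ≠ 0) :
    (MvPolynomial.X t * MvPolynomial.X 0 - MvPolynomial.X (update t l 0) * MvPolynomial.X (E1 l) :
      MvPolynomial (Fin s → Fin 2) K) ∈ homogVanishingIdeal (segX K s) := by
  refine ⟨⟨2, MvPolynomial.IsHomogeneous.sub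
    ((MvPolynomial.isHomogeneous_X K _).mul (MvPolynomial.isHomogeneous_X K _))
    ((MvPolynomial.isHomogeneous_X K _).mul (MvPolynomial.isHomogeneous_X K _))⟩, ?_⟩
  rintro x ⟨u, hu⟩ v hv
  rw [hu, Submodule.mem_span_singleton] at hv
  obtain ⟨c, rfl⟩ := hv
  have : (∏ i, u i (t i)) * ∏ i, u i ((0 : Fin s → Fin 2) i) =
      (∏ i, u i (update t l 0 i)) * ∏ i, u i (E1 l i) := by
    rw [← Finset.prod_mul_distrib, ← Finset.prod_mul_distrib]
    refine Finset.prod_congr rfl fun i _ => ?_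
    by_cases h : i = l
    · subst h
      have : t i = 1 := by revert ht; generalize t i = e; fin_cases e <;> simp
      simp [E1, this, mul_comm]
    · simp [E1, h]
  simp only [map_sub, map_mul, MvPolynomial.eval_X, Pi.smul_apply, smul_eq_mul]
  linear_combination c * c * this

theorem tangent_dot (x : Fin s → K) (F : (Fin s → Fin 2) → K) (h0 : F ⬝ᵥ av x = 0)
    (h1 : ∀ l, F ⬝ᵥ dav l x = 0) (z : PP K (Fin s → Fin 2))
    (hz : z ∈ embTangentSpace (segX K s) (pt x)) : F ⬝ᵥ z.rep = 0 := by
  classical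
  obtain ⟨c, hc, hrep⟩ := pt_rep x
  have key := tangent_rec x z.rep (by
    intro l t ht
    have := hz _ (quadric_mem l t ht)
    rw [hrep] at this
    simp only [map_sub, Derivation.leibniz, MvPolynomial.pderiv_X, smul_eq_mul, map_add, map_mul,
      MvPolynomial.eval_X, Pi.smul_apply, mul_sub, mul_add, Finset.sum_sub_distrib,
      Finset.sum_add_distrib] at this
    have e : ∀ (b : K) (r : Fin s → Fin 2), ∑ i, z.rep i * (b * MvPolynomial.eval (c • av x)
        ((Pi.single r 1 : (Fin s → Fin 2) → MvPolynomial (Fin s → Fin 2) K) i)) = z.rep r * b := by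
      intro b r
      rw [Finset.sum_eq_single r]
      · simp
      · intro j _ hj; simp [hj]
      · simp
    have e' : ∀ (b : K) (r : Fin s → Fin 2), ∑ i, z.rep i * (b * MvPolynomial.eval (c • av x)
        ((Pi.single i 1 : (Fin s → Fin 2) → MvPolynomial (Fin s → Fin 2) K) r)) = z.rep r * b := by
      intro b r
      rw [← e b r]
      refine Finset.sum_congr rfl fun i _ => ?_
      rw [Pi.single_apply, Pi.single_apply]
      simp only [eq_comm]
    simp only [e'] at this
    rw [av_zero, av_E1] at this
    have h2 : c * (z.rep t + z.rep 0 * av x t - (z.rep (update t l 0) * x l +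
      z.rep (E1 l) * av x (update t l 0))) = 0 := by linear_combination this
    exact sub_eq_zero.1 ((mul_eq_zero.1 h2).resolve_left hc))
  have : z.rep = z.rep 0 • av x + ∑ m, (z.rep (E1 m) - x m * z.rep 0) • dav m x := by
    ext t
    rw [key t]; simp
  rw [this, dotProduct_add, dotProduct_smul, h0, dotProduct_sum]
  simp [dotProduct_smul, h1]

/-- tangency at `pt ξ` -/
theorem tangency_dot [Infinite K] {k : ℕ} (y : Fin k → Fin s → K) (ξ : Fin s → K)
    (h : pt ξ ∈ tangencyLocus (segX K s) (Set.range fun i => pt (y i)))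
    (F : (Fin s → Fin 2) → K) (h0 : ∀ a, F ⬝ᵥ av (y a) = 0) (h1 : ∀ a l, F ⬝ᵥ dav l (y a) = 0)
    (l : Fin s) : F ⬝ᵥ dav l ξ = 0 := by
  have h2 : (Projectivization.mk K (dav l ξ) (dav_ne_zero l ξ)).submodule ≤
      vspan (⋃ a ∈ Set.range fun i => pt (y i), embTangentSpace (segX K s) a) :=
    h.2 (dav_mem_tangent ξ l)
  rw [Projectivization.submodule_mk, Submodule.span_singleton_le_iff_mem] at h2
  let φ : ((Fin s → Fin 2) → K) →ₗ[K] K :=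
    { toFun := fun w => F ⬝ᵥ w, map_add' := dotProduct_add F, map_smul' := fun c w => dotProduct_smul c F w }
  have h3 : vspan (⋃ a ∈ Set.range fun i => pt (y i), embTangentSpace (segX K s) a) ≤ LinearMap.ker φ := by
    unfold vspan
    rw [Submodule.span_le]
    intro w hw
    simp only [coneOf, Set.mem_iUnion, exists_prop] at hw
    obtain ⟨z, ⟨_, ⟨i, rfl⟩, hz⟩, hwz⟩ := hw
    have := tangent_dot (y i) F (h0 i) (h1 i) z hz
    rw [SetLike.mem_coe, Projectivization.submodule_eq, Submodule.mem_span_singleton] at hwz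
    obtain ⟨c, rfl⟩ := hwz
    change F ⬝ᵥ (c • z.rep) = 0
    rw [dotProduct_smul, this, smul_zero]
  exact h3 h2

end seg

section iso
variable {s : ℕ} {K : Type u} [Field K]

def mix {R : Type*} (p ξ : Fin s → R) (m : ℕ) : Fin s → R := fun j => if j.1 < m then ξ j else p j

theorem isolation (F : Fin s → Fin s → (Fin s → Fin 2) → K) (p : Fin s → K)
    (h0 : ∀ m₀ l, F m₀ l ⬝ᵥ dav l p = 0)
    (h1 : ∀ m₀ m, ∑ l, F m₀ l ⬝ᵥ ddav m l p = if m = m₀ then 1 else 0) :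
    ∃ P : MvPolynomial (Fin s) K, MvPolynomial.eval p P ≠ 0 ∧
      ∀ ξ, (∀ m₀ l, F m₀ l ⬝ᵥ dav l ξ = 0) → MvPolynomial.eval ξ P ≠ 0 → ξ = p := by
  let H : Matrix (Fin s) (Fin s) (MvPolynomial (Fin s) K) := Matrix.of fun m₀ m =>
    ∑ l, ∑ t, MvPolynomial.C (F m₀ l t) *
      ddav m l (mix (fun j => MvPolynomial.C (p j)) (fun j => MvPolynomial.X j) m) t
  have hH : ∀ ξ, MvPolynomial.eval ξ H.det =
      (Matrix.of fun m₀ (m : Fin s) => ∑ l, F m₀ l ⬝ᵥ ddav m l (mix p ξ m)).det := by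
    intro ξ
    rw [RingHom.map_det]
    congr 1
    ext m₀ m
    simp only [H, RingHom.mapMatrix_apply, Matrix.map_apply, Matrix.of_apply, map_sum, map_mul,
      map_ddav, dotProduct, MvPolynomial.eval_C]
    refine Finset.sum_congr rfl fun l _ => Finset.sum_congr rfl fun t _ => ?_
    congr 2
    ext j
    unfold mix
    split_ifs <;> simp
  refine ⟨H.det, ?_, ?_⟩
  · rw [hH]
    have : (Matrix.of fun m₀ (m : Fin s) => ∑ l, F m₀ l ⬝ᵥ ddav m l (mix p p m)) =
        (1 : Matrix (Fin s) (Fin s) K) := by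
      ext m₀ m
      have e : mix p p m = p := by ext j; simp [mix]
      rw [Matrix.of_apply, e, h1, Matrix.one_apply]
      simp only [eq_comm]
    rw [this]; simp
  · intro ξ hξ hP
    rw [hH] at hP
    have := Matrix.eq_zero_of_mulVec_eq_zero (v := ξ - p) hP (by
      ext m₀
      simp only [Matrix.mulVec, dotProduct, Matrix.of_apply, Pi.zero_apply]
      have step : ∀ m : Fin s, (∑ l, ∑ t, F m₀ l t * ddav m l (mix p ξ m) t) * (ξ - p) m =
          (fun n : ℕ => ∑ l, ∑ t, F m₀ l t * dav l (mix p ξ (n + 1)) t) m -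
          (fun n : ℕ => ∑ l, ∑ t, F m₀ l t * dav l (mix p ξ n) t) m := by
        intro m
        simp only [Finset.sum_mul, ← Finset.sum_sub_distrib]
        refine Finset.sum_congr rfl fun l _ => Finset.sum_congr rfl fun t _ => ?_
        have e1 : mix p ξ (m + 1) = update (mix p ξ m) m (ξ m) := by
          ext j
          by_cases h : j = m
          · subst h; simp [mix]
          · have : j.1 ≠ m.1 := fun h' => h (Fin.ext h')
            simp only [mix, update_of_ne h]
            congr 1
            exact propext ⟨fun _ => by omega, fun _ => by omega⟩
        have e2 : mix p ξ m = update (mix p ξ m) m (p m) := by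
          ext j
          by_cases h : j = m
          · subst h; simp [mix]
          · simp [h]
        have e3 := dav_update_sub (mix p ξ m) m l (ξ m) (p m) t
        rw [← e1, ← e2] at e3
        rw [Pi.sub_apply]
        linear_combination -F m₀ l t * e3
      rw [Finset.sum_congr rfl fun m _ => step m]
      rw [Fin.sum_univ_eq_sum_range (fun n : ℕ => (fun n : ℕ => ∑ l, ∑ t, F m₀ l t * dav l (mix p ξ (n + 1)) t) n -
          (fun n : ℕ => ∑ l, ∑ t, F m₀ l t * dav l (mix p ξ n) t) n)]
      rw [Finset.sum_range_sub (fun n : ℕ => ∑ l, ∑ t, F m₀ l t * dav l (mix p ξ n) t)]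
      have e4 : mix p ξ s = ξ := by ext j; simp [mix]
      have e5 : mix p ξ 0 = p := by ext j; simp [mix]
      rw [e4, e5]
      have a1 : ∑ l, ∑ t, F m₀ l t * dav l ξ t = 0 := Finset.sum_eq_zero fun l _ => hξ m₀ l
      have a2 : ∑ l, ∑ t, F m₀ l t * dav l p t = 0 := Finset.sum_eq_zero fun l _ => h0 m₀ l
      rw [a1, a2, sub_zero])
    exact sub_eq_zero.1 this

theorem homogenize (P : MvPolynomial (Fin s) K) : ∃ (Q : MvPolynomial (Fin s → Fin 2) K) (N : ℕ),
    Q.IsHomogeneous N ∧ ∀ (c : K) (ξ : Fin s → K), c ≠ 0 → MvPolynomial.eval (c • av ξ) Q = c ^ N *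
      MvPolynomial.eval ξ P := by
  induction P using MvPolynomial.induction_on with
  | C a => exact ⟨MvPolynomial.C a, 0, MvPolynomial.isHomogeneous_C _ _, fun c ξ _ => by simp⟩
  | add P P' h h' =>
    obtain ⟨Q, N, hQ, hv⟩ := h
    obtain ⟨Q', N', hQ', hv'⟩ := h'
    refine ⟨Q * MvPolynomial.X 0 ^ N' + MvPolynomial.X 0 ^ N * Q', N + N', ?_, ?_⟩
    · refine (hQ.mul ?_).add (MvPolynomial.IsHomogeneous.mul ?_ hQ')
      · simpa using (MvPolynomial.isHomogeneous_X K (0 : Fin s → Fin 2)).pow N'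
      · simpa using (MvPolynomial.isHomogeneous_X K (0 : Fin s → Fin 2)).pow N
    · intro c ξ hc
      simp only [map_add, map_mul, map_pow, hv c ξ hc, hv' c ξ hc, MvPolynomial.eval_X, Pi.smul_apply,
        av_zero, smul_eq_mul]
      ring
  | mul_X P l h =>
    obtain ⟨Q, N, hQ, hv⟩ := h
    refine ⟨Q * MvPolynomial.X (E1 l), N + 1, hQ.mul (MvPolynomial.isHomogeneous_X K _), ?_⟩
    intro c ξ hc
    simp only [map_mul, hv c ξ hc, MvPolynomial.eval_X, Pi.smul_apply, av_E1, smul_eq_mul]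
    ring

theorem contact_finite [Infinite K] {k : ℕ} (y : Fin k → Fin s → K) (hy : ∀ i, HessC y i) :
    zdim (contactLocus (segX K s) (Set.range fun i => pt (y i))) ≤ 0 := by
  apply zdim_finite (Set.finite_range fun i => pt (y i))
  apply zclosure_min _ (isZClosed_finite (Set.finite_range _))
  apply Set.iUnion₂_subset
  rintro C ⟨⟨hC1, hC2, -⟩, _, hC3, i, rfl⟩
  suffices C ⊆ {pt (y i)} by
    intro x hx
    rw [Set.mem_singleton_iff.1 (this hx)]; exact ⟨i, rfl⟩
  choose F hF1 hF2 hF3 using hy i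
  obtain ⟨P, hP, hP'⟩ := isolation F (y i) (fun m₀ l => hF2 m₀ l i l) hF3
  obtain ⟨Q, N, hQ, hQv⟩ := homogenize P
  have hYc : IsZClosed (zeroLocus {Q * MvPolynomial.X 0}) :=
    ⟨{Q * MvPolynomial.X 0}, fun f hf => ⟨N + 1, by
      rw [Set.mem_singleton_iff.1 hf]; exact hQ.mul (MvPolynomial.isHomogeneous_X K _)⟩, rfl⟩
  rcases hC1.2 {pt (y i)} _ (isZClosed_singleton _) hYc (by
    intro x hx
    by_contra hcon
    have hx1 : x ≠ pt (y i) := fun h => hcon (Or.inl h)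
    have hx2 : ¬ x ∈ zeroLocus {Q * MvPolynomial.X 0} := fun h => hcon (Or.inr h)
    simp only [zeroLocus, Set.mem_ofPred_eq, not_forall] at hx2
    obtain ⟨f, hf, v, hv, hne⟩ := hx2
    rw [Set.mem_singleton_iff] at hf
    subst hf
    have h3 := hom_rep_ne (hQ.mul (MvPolynomial.isHomogeneous_X K _)) x v hv hne
    rw [map_mul, MvPolynomial.eval_X] at h3
    have hxt := hC2 hx
    obtain ⟨ξ, rfl⟩ := exists_pt_of_rep hxt.1.1 (right_ne_zero_of_mul h3)
    obtain ⟨c, hc, hrep⟩ := pt_rep ξ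
    rw [hrep, hQv c ξ hc] at h3
    have h4 := right_ne_zero_of_mul (left_ne_zero_of_mul h3)
    exact hx1 (congrArg pt (hP' ξ (fun m₀ l => tangency_dot y ξ hxt (F m₀ l) (hF1 m₀ l) (hF2 m₀ l) l) h4)))
    with h | h
  · exact h
  · exfalso
    have := h hC3 _ rfl _ (smul_av_mem (y i) 1)
    rw [map_mul, hQv 1 _ one_ne_zero, MvPolynomial.eval_X] at this
    simp [av_zero] at this
    exact hP this

/-- pull back a multihomogeneous polynomial to affine coordinates -/
def pullPoly {k : ℕ} (c : Fin k → K) (f : MvPolynomial (Fin k × (Fin s → Fin 2)) K) :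
    MvPolynomial (Fin k × Fin s) K :=
  MvPolynomial.aeval (fun q => MvPolynomial.C (c q.1) * av (fun l => MvPolynomial.X (q.1, l)) q.2) f

theorem pullPoly_eval {k : ℕ} (c : Fin k → K) (f : MvPolynomial (Fin k × (Fin s → Fin 2)) K)
    (y : Fin k × Fin s → K) : MvPolynomial.aeval y (pullPoly c f) =
      MvPolynomial.eval (fun q => c q.1 * av (fun l => y (q.1, l)) q.2) f := by
  unfold pullPoly
  rw [← AlgHom.comp_apply, ← MvPolynomial.coe_aeval_eq_eval]
  change _ = (MvPolynomial.aeval _) f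
  congr 1
  apply MvPolynomial.algHom_ext
  intro q
  simp only [AlgHom.comp_apply, MvPolynomial.aeval_X, map_mul]
  have := map_av (MvPolynomial.aeval y : MvPolynomial _ K →ₐ[K] K).toRingHom (fun l => MvPolynomial.X (q.1, l)) q.2
  simp only [AlgHom.toRingHom_eq_coe, RingHom.coe_coe, MvPolynomial.aeval_X] at this
  rw [this]
  simp

theorem exists_generic [Infinite K] {k : ℕ} (T : Set (Fin k → PP K (Fin s → Fin 2)))
    (hT : IsMultiZClosed T) (u₀ : Fin k → PP K (Fin s → Fin 2)) (hu : ∀ i, u₀ i ∈ segX K s)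
    (hu' : u₀ ∉ T) (G : MvPolynomial (Fin k × Fin s) K) (hG : G ≠ 0) :
    ∃ y : Fin k → Fin s → K, MvPolynomial.aeval (fun p : Fin k × Fin s => y p.1 p.2) G ≠ 0 ∧
      (fun i => pt (y i)) ∉ T := by
  obtain ⟨S, -, rfl⟩ := hT
  simp only [multiZeroLocus, Set.mem_ofPred_eq, not_forall] at hu'
  obtain ⟨f, hf, v, hv, hne⟩ := hu'
  choose U hU using hu
  have hc : ∀ i, ∃ c : K, v i = c • fun t => ∏ l, U i l (t l) := by
    intro i
    have := hv i
    rw [hU, Submodule.mem_span_singleton] at this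
    obtain ⟨c, hc⟩ := this
    exact ⟨c, hc.symm⟩
  choose c hc using hc
  let Φ : MvPolynomial (Fin k × Fin s × Fin 2) K := MvPolynomial.aeval
    (fun q : Fin k × (Fin s → Fin 2) => MvPolynomial.C (c q.1) *
      ∏ l, MvPolynomial.X (q.1, l, q.2 l)) f
  have hΦ : ∀ w : Fin k × Fin s × Fin 2 → K, MvPolynomial.aeval w Φ =
      MvPolynomial.eval (fun q => c q.1 * ∏ l, w (q.1, l, q.2 l)) f := by
    intro w
    simp only [Φ]
    rw [← AlgHom.comp_apply, ← MvPolynomial.coe_aeval_eq_eval]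
    change _ = (MvPolynomial.aeval _) f
    congr 1
    apply MvPolynomial.algHom_ext
    intro q
    simp
  have hΦ0 : Φ ≠ 0 := by
    intro h0
    have := hΦ (fun q => U q.1 q.2.1 q.2.2)
    rw [h0, map_zero] at this
    apply hne
    rw [this]
    congr 2
    ext q
    rw [hc q.1]; rfl
  obtain ⟨w, hw⟩ := exists_eval_ne (mul_ne_zero hΦ0 (Finset.prod_ne_zero_iff.2
    fun (q : Fin k × Fin s) (_ : q ∈ univ) => MvPolynomial.X_ne_zero (R := K) (q.1, q.2, (0 : Fin 2))))
  rw [map_mul, map_prod] at hw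
  have hw1 := left_ne_zero_of_mul hw
  have hw2 := Finset.prod_ne_zero_iff.1 (right_ne_zero_of_mul hw)
  rw [hΦ] at hw1
  let c' : Fin k → K := fun i => c i * ∏ l, w (i, l, 0)
  have hf0 : pullPoly c' f ≠ 0 := by
    intro h0
    have := pullPoly_eval c' f (fun q => w (q.1, q.2, 1) / w (q.1, q.2, 0))
    rw [h0, map_zero] at this
    apply hw1
    rw [this]
    congr 2
    ext q
    have := congrFun (prod_eq_smul_av (fun l e => w (q.1, l, e)) (fun l => by
      simpa using hw2 (q.1, l) (mem_univ _))) q.2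
    simp only [Pi.smul_apply, smul_eq_mul] at this
    rw [this]; simp only [c']; ring
  obtain ⟨y, hy⟩ := exists_eval_ne (mul_ne_zero hf0 hG)
  rw [map_mul, pullPoly_eval] at hy
  refine ⟨fun i l => y (i, l), right_ne_zero_of_mul hy, fun hmem => left_ne_zero_of_mul hy ?_⟩
  exact hmem f hf (fun i => c' i • av (fun l => y (i, l))) (fun i => smul_av_mem _ _)

theorem not_weaklyDefective [Infinite K] (s k : ℕ) (hs : 5 ≤ s)
    (hineq : (k + s - 1) * (s + 1) ≤ 2 ^ s - 1) : ¬ WeaklyDefective (segX K s) k := by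
  rintro ⟨T, hT, ⟨u₀, hu, hu'⟩, h⟩
  obtain ⟨G, hG, hG'⟩ := main_gen (K := K) s k hs hineq
  obtain ⟨y, hy1, hy2⟩ := exists_generic T hT u₀ hu hu' G hG
  have h1 := h _ (fun i => pt_mem (y i)) hy2
  exact absurd h1 (not_lt.2 (contact_finite y (hG' K y hy1).2))

end iso

section derivs

open scoped IntermediateField.algebraAdjoinAdjoin in
theorem exists_derivation {K L J : Type*} [Field K] [CharZero K] [Field L] [Algebra K L]
    (v : J → L) (hv : IsTranscendenceBasis K v) (p : J) :
    ∃ D : Derivation K L L, D (v p) = 1 ∧ ∀ j, j ≠ p → D (v j) = 0 := by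
  classical
  have : Algebra.IsAlgebraic (IntermediateField.adjoin K (Set.range v)) L := hv.isAlgebraic_field
  have : CharZero (IntermediateField.adjoin K (Set.range v)) :=
    charZero_of_injective_algebraMap (algebraMap K _).injective
  have : Algebra.FormallyEtale (IntermediateField.adjoin K (Set.range v)) L :=
    Algebra.FormallyEtale.of_isSeparable _ _
  have : Algebra.FormallyEtale (Algebra.adjoin K (Set.range v))
    (IntermediateField.adjoin K (Set.range v)) := .of_isLocalization (nonZeroDivisors _)
  have : Algebra.FormallyEtale (Algebra.adjoin K (Set.range v)) L :=
    .comp _ (IntermediateField.adjoin K (Set.range v)) _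
  let e := hv.1.aevalEquiv
  have he : ∀ a, MvPolynomial.aeval v (e.symm a) = (a : L) := by
    intro a
    have := hv.1.algebraMap_aevalEquiv (e.symm a)
    rw [← this]
    simp [e]
  let d0 : Algebra.adjoin K (Set.range v) →ₗ[K] L :=
    (MvPolynomial.aeval v).toLinearMap ∘ₗ (MvPolynomial.pderiv p : Derivation K _ _).toLinearMap ∘ₗ
      e.symm.toLinearMap
  have hd0 : ∀ a, d0 a = MvPolynomial.aeval v (MvPolynomial.pderiv p (e.symm a)) := fun _ => rfl
  let d : Derivation K (Algebra.adjoin K (Set.range v)) L := Derivation.mk' d0 (by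
    intro a b
    simp only [hd0, map_mul, Derivation.leibniz, map_add, smul_eq_mul, he]
    rfl)
  have hd : ∀ a, d a = MvPolynomial.aeval v (MvPolynomial.pderiv p (e.symm a)) := fun _ => rfl
  let f := (LinearMap.liftBaseChange L d.liftKaehlerDifferential) ∘ₗ
    (KaehlerDifferential.tensorKaehlerEquivOfFormallyEtale K (Algebra.adjoin K (Set.range v)) L).symm.toLinearMap
  have key : ∀ j, f.compDer (KaehlerDifferential.D K L) (v j) =
      MvPolynomial.aeval v (MvPolynomial.pderiv p (MvPolynomial.X j : MvPolynomial J K)) := by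
    intro j
    have h1 : v j = algebraMap (Algebra.adjoin K (Set.range v)) L (e (MvPolynomial.X j)) := by
      rw [hv.1.algebraMap_aevalEquiv]; simp
    rw [h1]
    change LinearMap.liftBaseChange L d.liftKaehlerDifferential
      ((KaehlerDifferential.tensorKaehlerEquivOfFormallyEtale K (Algebra.adjoin K (Set.range v)) L).symm
        (KaehlerDifferential.D K L _)) = _
    rw [KaehlerDifferential.tensorKaehlerEquivOfFormallyEtale_symm_D_algebraMap]
    simp [hd]
  refine ⟨f.compDer (KaehlerDifferential.D K L), ?_, fun j hj => ?_⟩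
  · rw [key]; simp
  · rw [key, MvPolynomial.pderiv_X_of_ne hj]; simp

theorem exists_dual {K L P : Type*} [Field K] [CharZero K] [Field L] [Algebra K L]
    [DecidableEq P] (x : P → L) (hx : AlgebraicIndependent K x) :
    ∃ D : P → Derivation K L L, ∀ p q, D p (x q) = if q = p then 1 else 0 := by
  obtain ⟨t, ht, hb⟩ := exists_isTranscendenceBasis_superset hx.coe_range
  choose D hD hD' using exists_derivation _ hb
  refine ⟨fun p => D ⟨x p, ht ⟨p, rfl⟩⟩, fun p q => ?_⟩
  split_ifs with h
  · subst h; exact hD _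
  · exact hD' ⟨x p, ht ⟨p, rfl⟩⟩ ⟨x q, ht ⟨q, rfl⟩⟩ fun h' => h (hx.injective (by simpa using h'))

end derivs

section derivs2
variable {K L : Type*} [Field K] [Field L] [Algebra K L] {s k : ℕ}

theorem algInd_of_dual {P : Type*} [Fintype P] [DecidableEq P] [CharZero K] (x : P → L)
    (D : P → Derivation K L L)
    (h : ∀ p q, D p (x q) = if q = p then 1 else 0) (G : MvPolynomial P K)
    (hG : MvPolynomial.aeval x G = 0) : G = 0 := by
  have key : ∀ (n : ℕ) (G : MvPolynomial P K), (∀ m, MvPolynomial.coeff m G ≠ 0 → m.degree ≤ n) →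
      MvPolynomial.aeval x G = 0 → G = 0 := by
    intro n
    induction n with
    | zero =>
      intro G hd hG
      have : G = MvPolynomial.C (MvPolynomial.coeff 0 G) := by
        ext m
        rw [MvPolynomial.coeff_C]
        split_ifs with h
        · rw [← h]
        · by_contra hc
          exact h ((Finsupp.degree_eq_zero_iff m).1 (Nat.le_zero.1 (hd m hc))).symm
      rw [this] at hG ⊢
      simpa using hG
    | succ n ih =>
      intro G hd hG
      have h1 : ∀ p, MvPolynomial.pderiv p G = 0 := by
        intro p
        apply ih
        · intro m hm
          rw [MvPolynomial.coeff_pderiv] at hm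
          have := hd _ (left_ne_zero_of_mul hm)
          simpa [map_add] using this
        · have := deriv_aeval (D p) x G
          rw [hG, map_zero] at this
          simpa [h] using this.symm
      have : G = MvPolynomial.C (MvPolynomial.coeff 0 G) := by
        ext m
        rw [MvPolynomial.coeff_C]
        split_ifs with h
        · rw [← h]
        · obtain ⟨p, hp⟩ := Finsupp.ne_iff.1 (Ne.symm h)
          have h2 := congrArg (MvPolynomial.coeff (m - Finsupp.single p 1)) (h1 p)
          rw [MvPolynomial.coeff_pderiv, tsub_add_cancel_of_le
            (by rw [Finsupp.single_le_iff]; exact Nat.one_le_iff_ne_zero.2 hp), MvPolynomial.coeff_zero] at h2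
          exact (mul_eq_zero.1 h2).resolve_right (Nat.cast_add_one_ne_zero _)
      rw [this] at hG ⊢
      simpa using hG
  exact key (G.totalDegree) G (fun m hm => by
    have := MvPolynomial.le_totalDegree (MvPolynomial.mem_support_iff.2 hm)
    rwa [Finsupp.degree_apply]) hG

theorem D_prod {α : Type*} [DecidableEq α] (D : Derivation K L L) (S : Finset α) (f : α → L) :
    D (∏ i ∈ S, f i) = ∑ i ∈ S, D (f i) * ∏ j ∈ S.erase i, f j := by
  induction S using Finset.induction_on with
  | empty => simp
  | insert a S ha ih =>
    rw [Finset.prod_insert ha, Derivation.leibniz, ih, Finset.sum_insert ha, Finset.erase_insert ha,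
      add_comm, smul_eq_mul, smul_eq_mul, Finset.mul_sum]
    congr 1
    · ring
    · refine Finset.sum_congr rfl fun i hi => ?_
      rw [Finset.erase_insert_of_ne (by rintro rfl; exact ha hi), Finset.prod_insert (by simp [ha])]
      ring

theorem D_av (D : Derivation K L L) (w : Fin s → L) (t : Fin s → Fin 2) :
    D (av w t) = ∑ m, D (w m) * dav m w t := by
  unfold av
  rw [D_prod]
  refine Finset.sum_congr rfl fun m _ => ?_
  rw [dav_eq]
  split_ifs <;> simp

theorem ddav_symm {R : Type*} [CommRing R] (w : Fin s → R) (m l : Fin s) (t : Fin s → Fin 2) :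
    ddav m l w t = ddav l m w t := by
  by_cases h : m = l
  · subst h; rfl
  · unfold ddav dav
    simp only [update_comm h]
    ring

theorem D_dav (D : Derivation K L L) (w : Fin s → L) (l : Fin s) (t : Fin s → Fin 2) :
    D (dav l w t) = ∑ m, D (w m) * ddav m l w t := by
  conv_lhs => rw [dav]
  rw [map_sub, D_av, D_av, ← Finset.sum_sub_distrib]
  refine Finset.sum_congr rfl fun m _ => ?_
  by_cases h : m = l
  · subst h
    simp [ddav, dav_update_self]
  · rw [ddav_symm, ddav]
    simp only [update_of_ne h]
    ring

theorem D_dot (D : Derivation K L L) (f g : (Fin s → Fin 2) → L) :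
    D (f ⬝ᵥ g) = (fun t => D (f t)) ⬝ᵥ g + f ⬝ᵥ (fun t => D (g t)) := by
  simp only [dotProduct, map_sum, Derivation.leibniz, smul_eq_mul, ← Finset.sum_add_distrib]
  exact Finset.sum_congr rfl fun _ _ => by ring

/-- parametrised sums of `k` rank-one tensors -/
def tot {R : Type*} [CommRing R] (x : Fin k × Option (Fin s) → R) (t : Fin s → Fin 2) : R :=
  ∑ i, x (i, none) * av (fun l => x (i, some l)) t

theorem D_tot (D : Derivation K L L) (x : Fin k × Option (Fin s) → L) (t : Fin s → Fin 2) :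
    D (tot x t) = ∑ i, (D (x (i, none)) * av (fun l => x (i, some l)) t +
      ∑ m, (x (i, none) * D (x (i, some m))) * dav m (fun l => x (i, some l)) t) := by
  unfold tot
  rw [map_sum]
  refine Finset.sum_congr rfl fun i _ => ?_
  rw [Derivation.leibniz, D_av, smul_eq_mul, smul_eq_mul, Finset.mul_sum, add_comm]
  congr 1
  · ring
  · exact Finset.sum_congr rfl fun _ _ => by ring

theorem surD_indep {y : Fin k → Fin s → L} (hy : SurD y Set.univ) (α : Fin k → L)
    (β : Fin k → Fin s → L)
    (h : ∀ t, ∑ i, (α i * av (y i) t + ∑ m, β i m * dav m (y i) t) = 0) :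
    (∀ i, α i = 0) ∧ ∀ i m, β i m = 0 := by
  have key : ∀ (v : Fin k → L) (g : Fin k → Fin s → L), ∑ i, (α i * v i + ∑ m, β i m * g i m) = 0 := by
    intro v g
    obtain ⟨f, h1, h2⟩ := hy v g
    have : ∑ t, f t * ∑ i, (α i * av (y i) t + ∑ m, β i m * dav m (y i) t) = 0 :=
      Finset.sum_eq_zero fun t _ => by rw [h, mul_zero]
    rw [← this]
    simp only [Finset.mul_sum]
    rw [Finset.sum_comm]
    refine Finset.sum_congr rfl fun i _ => ?_
    simp only [mul_add, Finset.sum_add_distrib, ← h1, ← h2 _ (Set.mem_univ _), dotProduct, Finset.mul_sum]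
    congr 1
    · exact Finset.sum_congr rfl fun _ _ => by ring
    · rw [Finset.sum_comm]
      exact Finset.sum_congr rfl fun _ _ => Finset.sum_congr rfl fun _ _ => by ring
  constructor
  · intro i
    have := key (Pi.single i 1) 0
    simpa [Pi.single_apply] using this
  · intro i m
    have := key 0 (Pi.single i (Pi.single m 1))
    have e : ∀ a b, (Pi.single i (Pi.single m 1) : Fin k → Fin s → L) a b =
        if a = i then (if b = m then 1 else 0) else 0 := by
      intro a b
      by_cases h : a = i
      · subst h; simp [Pi.single_apply]
      · simp [h]
    simpa [e] using this

end derivs2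

section core
variable {K L : Type*} [Field K] [Field L] [Algebra K L] {s k : ℕ}

def Dual (D : Fin k × Option (Fin s) → Derivation K L L) (x : Fin k × Option (Fin s) → L) : Prop :=
  ∀ p q, D p (x q) = if q = p then 1 else 0

theorem D_tot_none {D : Fin k × Option (Fin s) → Derivation K L L} {x : Fin k × Option (Fin s) → L}
    (h : Dual D x) (i : Fin k) (t) : D (i, none) (tot x t) = av (fun l => x (i, some l)) t := by
  rw [D_tot]
  simp [h _ _]

theorem D_tot_some {D : Fin k × Option (Fin s) → Derivation K L L} {x : Fin k × Option (Fin s) → L}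
    (h : Dual D x) (i : Fin k) (l : Fin s) (t) :
    D (i, some l) (tot x t) = x (i, none) * dav l (fun l => x (i, some l)) t := by
  rw [D_tot]
  simp only [h _ _, Prod.mk.injEq, reduceCtorEq, and_false, if_false, zero_mul, zero_add, Option.some.injEq]
  rw [Finset.sum_eq_single i]
  · rw [Finset.sum_eq_single l]
    · simp
    · intro b _ hb; simp [hb]
    · simp
  · intro b _ hb; simp [hb]
  · simp

theorem perp_iff {D : Fin k × Option (Fin s) → Derivation K L L} {x : Fin k × Option (Fin s) → L}
    (h : Dual D x) (h0 : ∀ i, x (i, none) ≠ 0) (f : (Fin s → Fin 2) → L) :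
    (∀ p, f ⬝ᵥ (fun t => D p (tot x t)) = 0) ↔
      (∀ i, f ⬝ᵥ av (fun l => x (i, some l)) = 0) ∧
        ∀ i l, f ⬝ᵥ dav l (fun l => x (i, some l)) = 0 := by
  have e2 : ∀ i l, f ⬝ᵥ (fun t => D (i, some l) (tot x t)) =
      x (i, none) * f ⬝ᵥ dav l (fun l => x (i, some l)) := by
    intro i l
    simp only [D_tot_some h, dotProduct, Finset.mul_sum]
    exact Finset.sum_congr rfl fun _ _ => by ring
  have e1 : ∀ i, f ⬝ᵥ (fun t => D (i, none) (tot x t)) = f ⬝ᵥ av (fun l => x (i, some l)) := by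
    intro i
    simp only [D_tot_none h]
  constructor
  · intro H
    refine ⟨fun i => by rw [← e1]; exact H _, fun i l => ?_⟩
    have := H (i, some l)
    rw [e2] at this
    exact (mul_eq_zero.1 this).resolve_left (h0 i)
  · rintro ⟨H1, H2⟩ ⟨i, _ | l⟩
    · rw [e1, H1]
    · rw [e2, H2, mul_zero]

theorem dual_kill {D E : Fin k × Option (Fin s) → Derivation K L L}
    {x θ : Fin k × Option (Fin s) → L} (hD : Dual D x) (hE : Dual E θ) (hx : ∀ i, x (i, none) ≠ 0)
    (hθ : ∀ i, θ (i, none) ≠ 0) (htot : tot x = tot θ)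
    (c : Matrix (Fin k × Option (Fin s)) (Fin k × Option (Fin s)) L)
    (hc : ∀ p a, E p a = ∑ q, c p q * D q a)
    (c' : Matrix (Fin k × Option (Fin s)) (Fin k × Option (Fin s)) L)
    (hc' : ∀ p a, D p a = ∑ q, c' p q * E q a)
    (j : Fin k) (hH : HessC (fun j l => θ (j, some l)) j) (i : Fin k) (m : Fin s) :
    D (i, none) (θ (j, some m)) = 0 := by
  have hp : ∀ f : (Fin s → Fin 2) → L, (∀ p, f ⬝ᵥ (fun t => D p (tot x t)) = 0) ↔
      (∀ p, f ⬝ᵥ (fun t => E p (tot θ t)) = 0) := by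
    intro f
    constructor
    · intro H p
      have : f ⬝ᵥ (fun t => E p (tot θ t)) = ∑ q, c p q * f ⬝ᵥ (fun t => D q (tot x t)) := by
        simp only [hc, dotProduct, Finset.mul_sum, ← htot]
        rw [Finset.sum_comm]
        exact Finset.sum_congr rfl fun _ _ => Finset.sum_congr rfl fun _ _ => by ring
      rw [this]
      exact Finset.sum_eq_zero fun q _ => by rw [H, mul_zero]
    · intro H p
      have : f ⬝ᵥ (fun t => D p (tot x t)) = ∑ q, c' p q * f ⬝ᵥ (fun t => E q (tot θ t)) := by
        simp only [hc', dotProduct, Finset.mul_sum, ← htot]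
        rw [Finset.sum_comm]
        exact Finset.sum_congr rfl fun _ _ => Finset.sum_congr rfl fun _ _ => by ring
      rw [this]
      exact Finset.sum_eq_zero fun q _ => by rw [H, mul_zero]
  have hp' : ∀ f : (Fin s → Fin 2) → L, ((∀ i, f ⬝ᵥ av (fun l => x (i, some l)) = 0) ∧
        ∀ i l, f ⬝ᵥ dav l (fun l => x (i, some l)) = 0) ↔ ((∀ i, f ⬝ᵥ av (fun l => θ (i, some l)) = 0) ∧
        ∀ i l, f ⬝ᵥ dav l (fun l => θ (i, some l)) = 0) := by
    intro f
    rw [← perp_iff hD hx, ← perp_iff hE hθ, hp]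
  have hkx : ∀ a l, D (i, none) (x (a, some l)) = 0 := fun a l => by simp [hD _ _]
  have hstep : ∀ f : (Fin s → Fin 2) → L, (∀ a, f ⬝ᵥ av (fun l => θ (a, some l)) = 0) →
        (∀ a l, f ⬝ᵥ dav l (fun l => θ (a, some l)) = 0) → ∀ l,
        ∑ m, D (i, none) (θ (j, some m)) * f ⬝ᵥ ddav m l (fun l => θ (j, some l)) = 0 := by
    intro f h1 h2 l
    obtain ⟨g1, g2⟩ := (hp' f).2 ⟨h1, h2⟩
    have h3 : (∀ a, (fun t => D (i, none) (f t)) ⬝ᵥ av (fun l => x (a, some l)) = 0) ∧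
        ∀ a l, (fun t => D (i, none) (f t)) ⬝ᵥ dav l (fun l => x (a, some l)) = 0 := by
      constructor
      · intro a
        have := D_dot (D (i, none)) f (av fun l => x (a, some l))
        rw [g1 a, map_zero] at this
        simp only [D_av, hkx, zero_mul, Finset.sum_const_zero] at this
        simpa [dotProduct] using this.symm
      · intro a l
        have := D_dot (D (i, none)) f (dav l fun l => x (a, some l))
        rw [g2 a l, map_zero] at this
        simp only [D_dav, hkx, zero_mul, Finset.sum_const_zero] at this
        simpa [dotProduct] using this.symm
    have h4 := ((hp' _).1 h3).2 j l
    have h5 := D_dot (D (i, none)) f (dav l fun l => θ (j, some l))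
    rw [h2 j l, map_zero, h4, zero_add] at h5
    rw [h5]
    simp only [dotProduct, D_dav, Finset.mul_sum]
    rw [Finset.sum_comm]
    exact Finset.sum_congr rfl fun _ _ => Finset.sum_congr rfl fun _ _ => by ring
  obtain ⟨F, hF1, hF2, hF3⟩ := hH m
  have h6 : ∑ l, ∑ m, D (i, none) (θ (j, some m)) * F l ⬝ᵥ ddav m l (fun l => θ (j, some l)) = 0 :=
    Finset.sum_eq_zero fun l _ => hstep (F l) (hF1 l) (hF2 l) l
  rw [Finset.sum_comm] at h6
  simp only [← Finset.mul_sum, hF3] at h6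
  simpa using h6

theorem dual_match {D E : Fin k × Option (Fin s) → Derivation K L L} (hs : 0 < s)
    {x θ : Fin k × Option (Fin s) → L} (hD : Dual D x) (hE : Dual E θ)
    (htot : tot x = tot θ)
    (c : Matrix (Fin k × Option (Fin s)) (Fin k × Option (Fin s)) L)
    (hc : ∀ p a, E p a = ∑ q, c p q * D q a)
    (hS : SurD (fun j l => θ (j, some l)) Set.univ)
    (hkill : ∀ i j m, D (i, none) (θ (j, some m)) = 0) (i : Fin k) :
    ∃ j, ∃ c : L, av (fun l => x (i, some l)) = c • av (fun l => θ (j, some l)) := by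
  have h1 : ∀ i t, av (fun l => x (i, some l)) t =
      ∑ j, D (i, none) (θ (j, none)) * av (fun l => θ (j, some l)) t := by
    intro i t
    rw [← D_tot_none hD, htot, D_tot]
    simp [hkill]
  have h2 : ∀ i i' j l m, i' ≠ i → D (i, none) (θ (j, none)) ≠ 0 → D (i', some l) (θ (j, some m)) = 0 := by
    intro i i' j l m hii hne
    have h3 : ∀ t, ∑ j, (D (i', some l) (D (i, none) (θ (j, none))) * av (fun l => θ (j, some l)) t +
        ∑ m, (D (i, none) (θ (j, none)) * D (i', some l) (θ (j, some m))) *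
          dav m (fun l => θ (j, some l)) t) = 0 := by
      intro t
      have := congrArg (D (i', some l)) (h1 i t)
      rw [D_av] at this
      simp only [hD _ _, Prod.mk.injEq, Ne.symm hii, false_and, if_false, zero_mul, Finset.sum_const_zero] at this
      rw [this, map_sum]
      refine Finset.sum_congr rfl fun j _ => ?_
      rw [Derivation.leibniz, D_av, smul_eq_mul, smul_eq_mul, Finset.mul_sum, add_comm]
      congr 1
      · exact Finset.sum_congr rfl fun _ _ => by ring
      · ring
    have := (surD_indep hS _ _ h3).2 j m
    exact (mul_eq_zero.1 this).resolve_left hne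
  have h4 : ∀ j i i', D (i, none) (θ (j, none)) ≠ 0 → D (i', none) (θ (j, none)) ≠ 0 → i = i' := by
    intro j i i' hi hi'
    by_contra hne
    have h5 : ∀ p, D p (θ (j, some ⟨0, hs⟩)) = 0 := by
      rintro ⟨a, _ | l⟩
      · exact hkill _ _ _
      · by_cases ha : a = i
        · exact h2 i' a j l _ (by rw [ha]; exact hne) hi'
        · exact h2 i a j l _ ha hi
    have := hc (j, some ⟨0, hs⟩) (θ (j, some ⟨0, hs⟩))
    rw [hE] at this
    simp [h5] at this
  have h6 : ∀ i, ∃ j, D (i, none) (θ (j, none)) ≠ 0 := by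
    intro i
    by_contra hcon
    push Not at hcon
    have := h1 i 0
    rw [av_zero] at this
    simp [hcon] at this
  choose τ hτ using h6
  have hinj : Injective τ := fun a b hab => h4 (τ a) a b (hτ a) (by rw [hab]; exact hτ b)
  have hsurj := Finite.surjective_of_injective hinj
  refine ⟨τ i, D (i, none) (θ (τ i, none)), ?_⟩
  ext t
  rw [h1, Finset.sum_eq_single (τ i)]
  · rfl
  · intro b _ hb
    obtain ⟨a, rfl⟩ := hsurj b
    have : D (i, none) (θ (τ a, none)) = 0 := by
      by_contra hne
      exact hb (by rw [h4 _ _ _ hne (hτ a)])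
    rw [this, zero_mul]
  · simp

end core

section gen
variable {K : Type u} [Field K] {s k : ℕ}

open Classical in
/-- affine parameters of a tuple of rank-one tensors -/
def prm {L : Type*} [Field L] (z : Fin k → Fin s → Fin 2 → L) (p : Fin k × Option (Fin s)) : L :=
  match p with
  | (j, none) => ∏ l, if z j l 0 ≠ 0 then z j l 0 else z j l 1
  | (j, some l) => if z j l 0 ≠ 0 then z j l 1 / z j l 0 else 0

open Classical in
theorem prm_spec {L : Type*} [Field L] (z : Fin k → Fin s → Fin 2 → L) (j : Fin k) (t : Fin s → Fin 2) :
    ∏ l, z j l (t l) = prm z (j, none) * ∏ l, if z j l 0 ≠ 0 then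
      (if t l = 0 then 1 else prm z (j, some l)) else (if t l = 0 then 0 else 1) := by
  unfold prm
  simp only
  rw [← Finset.prod_mul_distrib]
  refine Finset.prod_congr rfl fun l _ => ?_
  have h01 : t l = 0 ∨ t l = 1 := by omega
  by_cases h0 : z j l 0 = 0
  · rcases h01 with h | h
    · simp [h0, h]
    · simp [h0, h]
  · rcases h01 with h | h
    · simp [h0, h]
    · simp only [h, h0, ne_eq, not_false_eq_true, if_true, Fin.one_eq_zero_iff, OfNat.ofNat_ne_one, if_false]
      field_simp

theorem der_sum {L : Type*} [Field L] [Algebra K L] {P : Type*} [Fintype P] (v : P → L)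
    (D : P → Derivation K L L) (a : L) : (∑ p, v p • D p) a = ∑ p, v p * D p a := by
  have := congrFun (map_sum (Derivation.coeFnAddMonoidHom (R := K) (A := L) (M := L))
    (fun p => v p • D p) univ) a
  rw [Finset.sum_apply] at this
  exact this

open Classical in
theorem prm_kill {L : Type*} [Field L] [Algebra K L] (z : Fin k → Fin s → Fin 2 → L) (j : Fin k)
    (t : Fin s → Fin 2) (D : Derivation K L L) (h : ∀ p, D (prm z p) = 0) :
    D (∏ l, z j l (t l)) = 0 := by
  rw [prm_spec, Derivation.leibniz, h, smul_zero, add_zero]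
  have : D (∏ l, if z j l 0 ≠ 0 then
      (if t l = 0 then 1 else prm z (j, some l)) else (if t l = 0 then 0 else 1)) = 0 := by
    rw [D_prod]
    refine Finset.sum_eq_zero fun l _ => ?_
    split_ifs <;> simp [h]
  rw [this, smul_zero]

theorem generic_unique [CharZero K] (s k : ℕ) (hs : 5 ≤ s)
    (hineq : (k + s - 1) * (s + 1) ≤ 2 ^ s - 1) (L : Type u) [Field L] [Algebra K L]
    (x : Fin k × Option (Fin s) → L) (hx : AlgebraicIndependent K x)
    (z : Fin k → Fin s → Fin 2 → L) (h : ∀ t, tot x t = ∑ j, ∏ l, z j l (t l)) :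
    (∀ j l, z j l 0 ≠ 0) ∧ ∀ i : Fin k, ∃ j, ∀ t t', av (fun l => x (i, some l)) t * ∏ l, z j l (t' l) =
      av (fun l => x (i, some l)) t' * ∏ l, z j l (t l) := by
  classical
  obtain ⟨G, hG, hG'⟩ := main_gen (K := K) s k hs hineq
  obtain ⟨D, hD⟩ := exists_dual x hx
  have hgen : ∀ (x : Fin k × Option (Fin s) → L), (∀ g : MvPolynomial (Fin k × Option (Fin s)) K,
      MvPolynomial.aeval x g = 0 → g = 0) → SurD (fun i l => x (i, some l)) Set.univ ∧
        ∀ i, HessC (fun i l => x (i, some l)) i := by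
    intro x hx
    apply hG' L
    intro h0
    apply hG
    apply MvPolynomial.rename_injective (fun p : Fin k × Fin s => (p.1, some p.2)) (by
      rintro ⟨a, b⟩ ⟨a', b'⟩ h; simpa using h)
    rw [map_zero]
    apply hx
    rw [MvPolynomial.aeval_rename]
    exact h0
  obtain ⟨hS, hH⟩ := hgen x fun g hg => (injective_iff_map_eq_zero _).1 hx g hg
  have hx0 : ∀ p, x p ≠ 0 := hx.ne_zero
  set θ := prm z with hθ
  let M : Matrix (Fin k × Option (Fin s)) (Fin k × Option (Fin s)) L := Matrix.of fun p q => D p (θ q)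
  have hM : M.det ≠ 0 := by
    intro h0
    obtain ⟨v, hv, hv'⟩ := Matrix.exists_vecMul_eq_zero_iff.2 h0
    apply hv
    let D' : Derivation K L L := ∑ p, v p • D p
    have hD' : ∀ a, D' a = ∑ p, v p * D p a := by
      intro a
      exact der_sum v D a
    have h1 : ∀ p, D' (θ p) = 0 := by
      intro p
      rw [hD']
      exact congrFun hv' p
    have h2 : ∀ t, D' (tot x t) = 0 := by
      intro t
      rw [h, map_sum]
      exact Finset.sum_eq_zero fun j _ => prm_kill z j t D' h1
    simp only [D_tot] at h2
    obtain ⟨h3, h4⟩ := surD_indep hS _ _ h2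
    have h5 : ∀ p, D' (x p) = v p := by
      intro p
      rw [hD']
      simp [hD]
    ext ⟨i, _ | l⟩
    · rw [← h5]; exact h3 i
    · rw [← h5]; exact (mul_eq_zero.1 (h4 i l)).resolve_left (hx0 _)
  have hθ0 : ∀ q, θ q ≠ 0 := by
    intro q hq
    apply hM
    exact Matrix.det_eq_zero_of_column_eq_zero q fun p => by simp [M, hq]
  have hz0 : ∀ j l, z j l 0 ≠ 0 := by
    intro j l h0
    apply hθ0 (j, some l)
    simp [hθ, prm, h0]
  have hb : ∀ j t, ∏ l, z j l (t l) = θ (j, none) * av (fun l => θ (j, some l)) t := by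
    intro j t
    rw [prm_spec]
    simp only [hz0, ne_eq, not_false_eq_true, if_true]
    rfl
  let E : Fin k × Option (Fin s) → Derivation K L L := fun p => ∑ q, M⁻¹ p q • D q
  have hE' : ∀ p a, E p a = ∑ q, M⁻¹ p q * D q a := by
    intro p a
    exact der_sum _ D a
  have hE : Dual E θ := by
    intro p q
    rw [hE']
    have := congrFun (congrFun (Matrix.nonsing_inv_mul M (isUnit_iff_ne_zero.2 hM)) p) q
    rw [Matrix.mul_apply, Matrix.one_apply] at this
    simp only [M, Matrix.of_apply] at this
    simp only [eq_comm (a := q)]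
    exact this
  have hDE : ∀ p a, D p a = ∑ q, M p q * E q a := by
    intro p a
    have := congrFun (congrArg (fun N => Matrix.mulVec N fun q => D q a)
      (Matrix.mul_nonsing_inv M (isUnit_iff_ne_zero.2 hM))) p
    simp only [← Matrix.mulVec_mulVec, Matrix.one_mulVec] at this
    rw [← this]
    simp only [Matrix.mulVec, dotProduct, hE']
  obtain ⟨hS', hH'⟩ := hgen θ fun g hg => algInd_of_dual θ E hE g hg
  have htot : tot x = tot θ := by
    ext t
    rw [h, tot]
    exact Finset.sum_congr rfl fun j _ => hb j t
  have hk := fun i j m => dual_kill hD hE (fun i => hx0 _) (fun i => hθ0 _) htot _ hE' _ hDE j (hH' j) i m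
  refine ⟨hz0, fun i => ?_⟩
  obtain ⟨j, c, hc⟩ := dual_match (by omega) hD hE htot _ hE' hS' hk i
  refine ⟨j, fun t t' => ?_⟩
  rw [hb, hb, hc]
  simp only [Pi.smul_apply, smul_eq_mul]
  ring

end gen

section transfer
variable {K : Type u} [Field K] {s k : ℕ}

theorem map_tot {R S : Type*} [CommRing R] [CommRing S] (φ : R →+* S)
    (x : Fin k × Option (Fin s) → R) (t) : φ (tot x t) = tot (fun p => φ (x p)) t := by
  simp only [tot, map_sum, map_mul, map_av]

abbrev RR (K : Type u) [Field K] (s k : ℕ) := MvPolynomial (Fin k × Option (Fin s)) K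
abbrev SS (K : Type u) [Field K] (s k : ℕ) :=
  MvPolynomial (Option (Fin k × Fin s × Fin 2)) (RR K s k)

/-- universal second decomposition -/
def ub (j : Fin k) (t : Fin s → Fin 2) : SS K s k := ∏ l, MvPolynomial.X (some (j, l, t l))

def uminor (i : Fin k) (τ : Fin k → (Fin s → Fin 2) × (Fin s → Fin 2)) : SS K s k :=
  ∏ j, (MvPolynomial.C (av (fun l => MvPolynomial.X (i, some l)) (τ j).1) * ub j (τ j).2 -
    MvPolynomial.C (av (fun l => MvPolynomial.X (i, some l)) (τ j).2) * ub j (τ j).1)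

def badIdeal (K : Type u) [Field K] (s k : ℕ) (e : SS K s k) :
    Ideal (SS K s k) :=
  Ideal.span (insert e
    (Set.range fun t => MvPolynomial.C (tot MvPolynomial.X t) - ∑ j, ub j t))

theorem exists_field {S : Type u} [CommRing S] (I : Ideal S) (M : Submonoid S)
    (h : Disjoint (I : Set S) M) : ∃ (L : Type u) (_ : Field L) (ψ : S →+* L),
      (∀ f ∈ I, ψ f = 0) ∧ ∀ g ∈ M, ψ g ≠ 0 := by
  obtain ⟨p, hp, hJp, hdis⟩ := Ideal.exists_le_prime_disjoint I M h
  refine ⟨FractionRing (S ⧸ p), inferInstance,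
      (algebraMap (S ⧸ p) _).comp (Ideal.Quotient.mk p), fun f hf => ?_, fun g hg h0 => ?_⟩
  · rw [RingHom.comp_apply, Ideal.Quotient.eq_zero_iff_mem.2 (hJp hf), map_zero]
  · rw [RingHom.comp_apply] at h0
    have h1 := (IsFractionRing.injective (S ⧸ p) (FractionRing (S ⧸ p)))
        (h0.trans (map_zero _).symm)
    exact Set.disjoint_left.1 hdis (Ideal.Quotient.eq_zero_iff_mem.1 h1) hg

theorem exists_elim [CharZero K] (s k : ℕ) (hs : 5 ≤ s)
    (hineq : (k + s - 1) * (s + 1) ≤ 2 ^ s - 1) (e : SS K s k)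
    (he : (∃ i τ, e = 1 - MvPolynomial.X none * uminor i τ) ∨
      ∃ j l, e = MvPolynomial.X (some (j, l, 0))) :
    ∃ g : RR K s k, g ≠ 0 ∧ MvPolynomial.C g ∈ badIdeal K s k e := by
  by_contra hcon
  push Not at hcon
  obtain ⟨L, _, ψ, hψ, hψ0⟩ : ∃ (L : Type u) (_ : Field L) (ψ : SS K s k →+* L),
      (∀ f ∈ badIdeal K s k e, ψ f = 0) ∧ ∀ g, g ≠ 0 → ψ (MvPolynomial.C g) ≠ 0 := by
    obtain ⟨L, hL, ψ, h1, h2⟩ := exists_field (badIdeal K s k e)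
      ((nonZeroDivisors (RR K s k)).map (MvPolynomial.C : RR K s k →+* SS K s k))
      (by
        rw [Set.disjoint_left]
        rintro _ hf ⟨g, hg, rfl⟩
        exact hcon g (nonZeroDivisors.ne_zero hg) hf)
    exact ⟨L, hL, ψ, h1, fun g hg => h2 _ ⟨g, mem_nonZeroDivisors_of_ne_zero hg, rfl⟩⟩
  let _ : Algebra K L := (ψ.comp (MvPolynomial.C.comp MvPolynomial.C)).toAlgebra
  let x : Fin k × Option (Fin s) → L := fun p => ψ (MvPolynomial.C (MvPolynomial.X p))
  have hae : ∀ g, MvPolynomial.aeval x g = ψ (MvPolynomial.C g) := by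
    intro g
    have : (MvPolynomial.aeval x : RR K s k →ₐ[K] L).toRingHom = ψ.comp MvPolynomial.C := by
      apply MvPolynomial.ringHom_ext
      · intro a
        simp
        rfl
      · intro p
        simp [x]
    exact congrArg (fun f : RR K s k →+* L => f g) this
  have hx : AlgebraicIndependent K x := by
    apply (injective_iff_map_eq_zero _).2
    intro g hg
    by_contra hne
    exact hψ0 g hne (by rw [← hae]; exact hg)
  have hub : ∀ j t, ψ (ub j t) = ∏ l, ψ (MvPolynomial.X (some (j, l, t l))) := by
    intro j t; simp [ub, map_prod]
  obtain ⟨hz0, hun⟩ := generic_unique s k hs hineq L x hx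
    (fun j l e => ψ (MvPolynomial.X (some (j, l, e)))) (by
      intro t
      have := hψ _ (Ideal.subset_span (Or.inr ⟨t, rfl⟩))
      rw [map_sub, sub_eq_zero, ← RingHom.comp_apply, map_tot, map_sum] at this
      simp only [hub] at this
      exact this)
  have h1 := hψ _ (Ideal.subset_span (Or.inl rfl))
  rcases he with ⟨i, τ, rfl⟩ | ⟨j, l, rfl⟩
  · obtain ⟨j, hj⟩ := hun i
    have hav : ∀ t, ψ (MvPolynomial.C (av (fun l => MvPolynomial.X (i, some l)) t)) =
        av (fun l => x (i, some l)) t := by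
      intro t
      rw [← RingHom.comp_apply, map_av]
      rfl
    rw [map_sub, map_mul, uminor, map_prod, Finset.prod_eq_zero (Finset.mem_univ j)] at h1
    · simp at h1
    · rw [map_sub, map_mul, map_mul, hub, hub, hav, hav, hj, sub_self]
  · exact hz0 j l h1

theorem exists_good [CharZero K] (s k : ℕ) (hs : 5 ≤ s)
    (hineq : (k + s - 1) * (s + 1) ≤ 2 ^ s - 1) :
    ∃ g : RR K s k, g ≠ 0 ∧ ∀ a : Fin k × Option (Fin s) → K, MvPolynomial.eval a g ≠ 0 →
      ∀ z : Fin k → Fin s → Fin 2 → K, (∀ t, tot a t = ∑ j, ∏ l, z j l (t l)) →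
        (∀ j l, z j l 0 ≠ 0) ∧
        ∀ i, ∃ j, ∀ t t', av (fun l => a (i, some l)) t * ∏ l, z j l (t' l) =
          av (fun l => a (i, some l)) t' * ∏ l, z j l (t l) := by
  choose g hg hg' using fun i τ => exists_elim (K := K) s k hs hineq _ (Or.inl ⟨i, τ, rfl⟩)
  choose f hf hf' using fun j l => exists_elim (K := K) s k hs hineq _ (Or.inr ⟨j, l, rfl⟩)
  refine ⟨(∏ j, ∏ l, f j l) * ∏ i, ∏ τ, g i τ, mul_ne_zero
    (Finset.prod_ne_zero_iff.2 fun i _ => Finset.prod_ne_zero_iff.2 fun τ _ => hf i τ)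
    (Finset.prod_ne_zero_iff.2 fun i _ => Finset.prod_ne_zero_iff.2 fun τ _ => hg i τ), ?_⟩
  intro a ha z hz
  simp only [map_prod, map_mul] at ha
  obtain ⟨ha', ha⟩ := mul_ne_zero_iff.1 ha
  have key : ∀ (e : SS K s k) (w : K), MvPolynomial.eval₂Hom (MvPolynomial.eval a)
      (fun o : Option (Fin k × Fin s × Fin 2) => o.elim w fun q => z q.1 q.2.1 q.2.2) e = 0 →
      ∀ g, MvPolynomial.C g ∈ badIdeal K s k e → MvPolynomial.eval a g = 0 := by
    intro e w he g hg
    let φ : SS K s k →+* K := MvPolynomial.eval₂Hom (MvPolynomial.eval a)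
      fun o => o.elim w fun q => z q.1 q.2.1 q.2.2
    have hub : ∀ j t, φ (ub j t) = ∏ l, z j l (t l) := by
      intro j t; simp [ub, φ]
    have hC : ∀ f, φ (MvPolynomial.C f) = MvPolynomial.eval a f := by
      intro f; simp [φ]
    have : badIdeal K s k e ≤ RingHom.ker φ := by
      apply Ideal.span_le.2
      rintro _ (rfl | ⟨t, rfl⟩)
      · exact he
      · rw [SetLike.mem_coe, RingHom.mem_ker, map_sub, map_sum, hC, map_tot]
        simp only [hub, MvPolynomial.eval_X]
        rw [← hz, sub_self]
    have h2 := this hg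
    rwa [RingHom.mem_ker, hC] at h2
  refine ⟨fun j l h0 => ?_, fun i => ?_⟩
  · exact Finset.prod_ne_zero_iff.1 (Finset.prod_ne_zero_iff.1 ha' j (mem_univ _)) l (mem_univ _)
      (key _ 0 (by simp [h0]) _ (hf' j l))
  by_contra hcon
  push Not at hcon
  choose t t' hne using hcon
  let τ : Fin k → (Fin s → Fin 2) × (Fin s → Fin 2) := fun j => (t j, t' j)
  apply Finset.prod_ne_zero_iff.1 (Finset.prod_ne_zero_iff.1 ha i (mem_univ _)) τ (mem_univ _)
  let mm : K := ∏ j, (av (fun l => a (i, some l)) (t j) * ∏ l, z j l (t' j l) -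
          av (fun l => a (i, some l)) (t' j) * ∏ l, z j l (t j l))
  have hmm : mm ≠ 0 := Finset.prod_ne_zero_iff.2 fun j _ => sub_ne_zero.2 (hne j)
  refine key _ mm⁻¹ ?_ _ (hg' i τ)
  have hav : ∀ t, MvPolynomial.eval a (av (fun l => MvPolynomial.X (i, some l)) t) =
      av (fun l => a (i, some l)) t := by
    intro t; rw [map_av]; simp
  have : MvPolynomial.eval₂Hom (MvPolynomial.eval a)
      (fun o : Option (Fin k × Fin s × Fin 2) => o.elim mm⁻¹ fun q => z q.1 q.2.1 q.2.2)
      (uminor i τ) = mm := by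
    simp only [uminor, ub, map_prod, map_sub, map_mul, MvPolynomial.coe_eval₂Hom,
      MvPolynomial.eval₂_C, MvPolynomial.eval₂_X, hav, mm, τ, Option.elim]
  rw [map_sub, map_mul, this, map_one]
  simp [inv_mul_cancel₀ hmm]

end transfer

section chev
variable {K : Type u} [Field K]

theorem chevalley [IsAlgClosed K] {ι σ : Type} [Finite ι] [Finite σ]
    (ψ : MvPolynomial ι K →ₐ[K] MvPolynomial σ K) (G : MvPolynomial σ K) (hG : G ≠ 0) :
    ∃ F, ψ F ≠ 0 ∧ ∀ v : ι → K, (∀ f, ψ f = 0 → MvPolynomial.eval v f = 0) →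
      MvPolynomial.eval v F ≠ 0 →
      ∃ a : σ → K, (∀ t, MvPolynomial.eval a (ψ (MvPolynomial.X t)) = v t) ∧
        MvPolynomial.eval a G ≠ 0 := by
  have hfin : ψ.toRingHom.FinitePresentation := by
    rw [← RingHom.FinitePresentation.of_finiteType]
    have h : (ψ.toRingHom.comp (algebraMap K (MvPolynomial ι K))).FiniteType := by
      have : ψ.toRingHom.comp (algebraMap K (MvPolynomial ι K)) =
          algebraMap K (MvPolynomial σ K) := ψ.comp_algebraMap
      rw [this, RingHom.finiteType_algebraMap]
      infer_instance
    exact RingHom.FiniteType.of_comp_finiteType h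
  obtain ⟨S, hS⟩ := PrimeSpectrum.exists_constructibleSetData_iff.2
    (PrimeSpectrum.isConstructible_comap_image hfin
      (PrimeSpectrum.isConstructible_basicOpen (f := G)))
  have hbot : PrimeSpectrum.comap ψ.toRingHom ⊥ ∈ S.toSet := by
    rw [hS]
    exact ⟨⊥, by simpa using hG, rfl⟩
  simp only [PrimeSpectrum.ConstructibleSetData.toSet, Set.mem_iUnion] at hbot
  obtain ⟨C, hCS, hC⟩ := hbot
  obtain ⟨h1, h2⟩ := hC
  have h1' : ∀ i, ψ (C.g i) = 0 := by
    intro i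
    have := h1 ⟨i, rfl⟩
    simpa using this
  refine ⟨C.f, fun h => h2 ?_, ?_⟩
  · rintro _ rfl
    simpa using h
  intro v hv hF
  have hmem : (⟨RingHom.ker (MvPolynomial.eval v), RingHom.ker_isPrime _⟩ :
      PrimeSpectrum (MvPolynomial ι K)) ∈ S.toSet := by
    simp only [PrimeSpectrum.ConstructibleSetData.toSet, Set.mem_iUnion]
    refine ⟨C, hCS, ?_, ?_⟩
    · rintro _ ⟨i, rfl⟩
      exact hv _ (h1' i)
    · intro h
      exact hF (h rfl)
  rw [hS] at hmem
  obtain ⟨p, hp, hpv⟩ := hmem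
  have hpv' : ∀ f, ψ f ∈ p.asIdeal ↔ MvPolynomial.eval v f = 0 := by
    intro f
    have := congrArg PrimeSpectrum.asIdeal hpv
    have := SetLike.ext_iff.1 this f
    exact this
  have hp' : G ∉ p.asIdeal := hp
  have hpp := p.isPrime
  rw [← MvPolynomial.IsPrime.vanishingIdeal_zeroLocus (K := K) p.asIdeal,
    MvPolynomial.mem_vanishingIdeal_iff] at hp'
  push Not at hp'
  obtain ⟨a, ha, hGa⟩ := hp'
  refine ⟨a, fun t => ?_, by simpa [MvPolynomial.coe_aeval_eq_eval] using hGa⟩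
  have h3 := (hpv' (MvPolynomial.X t - MvPolynomial.C (v t))).2 (by simp)
  have h4 := MvPolynomial.mem_zeroLocus_iff.1 ha _ h3
  simp only [map_sub] at h4
  rw [sub_eq_zero] at h4
  rw [show MvPolynomial.C (v t) = algebraMap K (MvPolynomial ι K) (v t) from rfl,
    AlgHom.commutes] at h4
  simpa using h4

end chev

section scale
variable {K : Type u} [Field K] {ι : Type}

/-- restriction of a polynomial to a line through the origin -/
def linePoly (v : ι → K) (f : MvPolynomial ι K) : Polynomial K :=
  ∑ d ∈ range (f.totalDegree + 1), Polynomial.C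
    (MvPolynomial.eval v (MvPolynomial.homogeneousComponent d f)) * Polynomial.X ^ d

theorem linePoly_eval (v : ι → K) (f : MvPolynomial ι K) (c : K) :
    (linePoly v f).eval c = MvPolynomial.eval (c • v) f := by
  conv_rhs => rw [← MvPolynomial.sum_homogeneousComponent f]
  rw [linePoly, Polynomial.eval_finsetSum, map_sum]
  refine Finset.sum_congr rfl fun d _ => ?_
  rw [hom_eval (MvPolynomial.homogeneousComponent_isHomogeneous d f)]
  rw [Polynomial.eval_mul, Polynomial.eval_C, Polynomial.eval_pow, Polynomial.eval_X, mul_comm]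

theorem linePoly_coeff (v : ι → K) (f : MvPolynomial ι K) (d : ℕ) :
    (linePoly v f).coeff d = MvPolynomial.eval v (MvPolynomial.homogeneousComponent d f) := by
  rw [linePoly, Polynomial.finsetSum_coeff]
  simp only [Polynomial.coeff_C_mul, Polynomial.coeff_X_pow, mul_ite, mul_one, mul_zero]
  rw [Finset.sum_ite_eq]
  split_ifs with h
  · rfl
  · rw [MvPolynomial.homogeneousComponent_eq_zero, map_zero]
    simpa [Nat.lt_succ_iff] using h

end scale

section dec
variable {K : Type u} [Field K] {s k : ℕ}

/-- the sum of rank-one tensors -/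
def rk (z : Fin k → Fin s → Fin 2 → K) (t : Fin s → Fin 2) : K := ∑ j, ∏ l, z j l (t l)

/-- the parametrisation of the secant cone -/
def par (K : Type u) [Field K] (s k : ℕ) : MvPolynomial (Fin s → Fin 2) K →ₐ[K] RR K s k :=
  MvPolynomial.aeval fun t => tot MvPolynomial.X t

theorem eval_par (a : Fin k × Option (Fin s) → K) (f : MvPolynomial (Fin s → Fin 2) K) :
    MvPolynomial.eval a (par K s k f) = MvPolynomial.eval (tot a) f := by
  have : (MvPolynomial.eval a).comp (par K s k).toRingHom = MvPolynomial.eval (tot a) := by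
    apply MvPolynomial.ringHom_ext
    · intro r; simp [par]
    · intro t
      simp only [par, AlgHom.toRingHom_eq_coe, RingHom.comp_apply, RingHom.coe_coe,
        MvPolynomial.aeval_X, map_tot, MvPolynomial.eval_X]
  exact DFunLike.congr_fun this f

theorem par_rk [Infinite K] {f : MvPolynomial (Fin s → Fin 2) K} (hf : par K s k f = 0)
    (z : Fin k → Fin s → Fin 2 → K) : MvPolynomial.eval (rk z) f = 0 := by
  let P : MvPolynomial (Fin k × Fin s × Fin 2) K :=
    MvPolynomial.aeval (fun t : Fin s → Fin 2 => ∑ j, ∏ l, MvPolynomial.X (j, l, t l)) f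
  have hP : ∀ w : Fin k × Fin s × Fin 2 → K, MvPolynomial.eval w P =
      MvPolynomial.eval (rk fun j l e => w (j, l, e)) f := by
    intro w
    have : (MvPolynomial.eval w).comp (MvPolynomial.aeval (R := K)
        (fun t : Fin s → Fin 2 => (∑ j, ∏ l, MvPolynomial.X (j, l, t l) :
          MvPolynomial (Fin k × Fin s × Fin 2) K))).toRingHom =
        MvPolynomial.eval (rk fun j l e => w (j, l, e)) := by
      apply MvPolynomial.ringHom_ext
      · intro r; simp
      · intro t
        simp [rk]
    exact DFunLike.congr_fun this f
  have h0 : P * ∏ j : Fin k, ∏ l : Fin s, MvPolynomial.X (j, l, 0) = 0 := by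
    apply MvPolynomial.funext
    intro w
    rw [map_mul, hP, map_zero]
    by_cases hw : ∀ j l, w (j, l, 0) ≠ 0
    · have : rk (fun j l e => w (j, l, e)) = tot (fun p : Fin k × Option (Fin s) => p.2.elim
          (∏ l, w (p.1, l, 0)) fun l => w (p.1, l, 1) / w (p.1, l, 0)) := by
        ext t
        refine Finset.sum_congr rfl fun j _ => ?_
        exact congrFun (prod_eq_smul_av (fun l e => w (j, l, e)) (hw j)) t
      rw [this, ← eval_par, hf, map_zero, zero_mul]
    · push Not at hw
      obtain ⟨j, l, h⟩ := hw
      simp only [map_prod, MvPolynomial.eval_X]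
      rw [Finset.prod_eq_zero (mem_univ j) (Finset.prod_eq_zero (mem_univ l) h), mul_zero]
  have h1 : P = 0 := (mul_eq_zero.1 h0).resolve_right
    (Finset.prod_ne_zero_iff.2 fun j _ => Finset.prod_ne_zero_iff.2 fun l _ => MvPolynomial.X_ne_zero _)
  have h2 := hP fun p => z p.1 p.2.1 p.2.2
  rw [h1, map_zero] at h2
  exact h2.symm

theorem par_hom [Infinite K] {f : MvPolynomial (Fin s → Fin 2) K} (hf : par K s k f = 0) (d : ℕ) :
    par K s k (MvPolynomial.homogeneousComponent d f) = 0 := by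
  apply MvPolynomial.funext
  intro a
  rw [eval_par, map_zero, ← linePoly_coeff]
  have : linePoly (tot a) f = 0 := by
    apply Polynomial.funext
    intro c
    rw [linePoly_eval]
    have : c • tot a = tot (fun p : Fin k × Option (Fin s) => p.2.elim (c * a (p.1, none))
        fun l => a (p.1, some l)) := by
      ext t
      simp only [tot, Pi.smul_apply, smul_eq_mul, Finset.mul_sum, Option.elim, mul_assoc]
    rw [this, ← eval_par, hf, map_zero, Polynomial.eval_zero]
  rw [this, Polynomial.coeff_zero]

theorem exists_rk (hs : 0 < s) (S : Finset (PP K (Fin s → Fin 2))) (hS : ↑S ⊆ segX K s)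
    (hc : S.card ≤ k) (v : (Fin s → Fin 2) → K) (hv : v ∈ vspan (S : Set (PP K (Fin s → Fin 2)))) :
    ∃ z : Fin k → Fin s → Fin 2 → K, v = rk z ∧
      ∀ j, z j = 0 ∨ ∃ x ∈ S, (fun t => ∏ l, z j l (t l)) ∈ x.submodule := by
  classical
  have h1 : v ∈ ⨆ x ∈ S, x.submodule := by
    have : vspan (S : Set (PP K (Fin s → Fin 2))) ≤ ⨆ x ∈ S, x.submodule := by
      apply Submodule.span_le.2
      intro w hw
      simp only [coneOf, Set.mem_iUnion] at hw
      obtain ⟨x, hx, hw⟩ := hw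
      exact Submodule.mem_iSup_of_mem x (Submodule.mem_iSup_of_mem hx hw)
    exact this hv
  rw [Submodule.mem_iSup_finset_iff_exists_sum] at h1
  obtain ⟨μ, hμ⟩ := h1
  have h2 : ∀ x : S, ∃ z : Fin s → Fin 2 → K,
      (μ x : (Fin s → Fin 2) → K) = fun t => ∏ l, z l (t l) := by
    intro x
    obtain ⟨u, hu⟩ := hS x.2
    have h3 : ((μ x : _) : (Fin s → Fin 2) → K) ∈ x.1.submodule := (μ x).2
    generalize ((μ x : _) : (Fin s → Fin 2) → K) = m at h3 ⊢
    rw [hu, Submodule.mem_span_singleton] at h3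
    obtain ⟨c, hc⟩ := h3
    refine ⟨fun l e => (if l = ⟨0, hs⟩ then c else 1) * u l e, ?_⟩
    rw [← hc]
    ext t
    rw [Finset.prod_mul_distrib, Finset.prod_ite_eq', if_pos (mem_univ _)]
    rfl
  choose z hz using h2
  obtain ⟨e⟩ : Nonempty (S ↪ Fin k) := by
    apply Function.Embedding.nonempty_of_card_le
    simpa using hc
  have he : ∀ x, Function.extend e z 0 (e x) = z x := fun x => e.injective.extend_apply _ _ _
  refine ⟨Function.extend e z 0, ?_, ?_⟩
  · rw [← hμ, ← Finset.sum_coe_sort]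
    ext t
    rw [Finset.sum_apply, rk]
    have : ∑ j ∈ univ.map e, ∏ l, Function.extend e z 0 j l (t l) =
        ∑ j, ∏ l, Function.extend e z 0 j l (t l) := by
      apply Finset.sum_subset (Finset.subset_univ _)
      intro j _ hj
      rw [Function.extend_apply' _ _ _ (by
        rintro ⟨x, rfl⟩
        exact hj (Finset.mem_map_of_mem _ (mem_univ _)))]
      exact Finset.prod_eq_zero (mem_univ ⟨0, hs⟩) rfl
    rw [← this, Finset.sum_map]
    refine Finset.sum_congr rfl fun x _ => ?_
    rw [he, hz]
  · intro j
    by_cases hj : ∃ x, e x = j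
    · obtain ⟨x, rfl⟩ := hj
      right
      refine ⟨x, x.2, ?_⟩
      rw [he, ← hz]
      exact (μ x).2
    · left
      rw [Function.extend_apply' _ _ _ hj]; rfl

end dec

section ident
variable {K : Type u} [Field K] {s k : ℕ}

theorem secant_par [Infinite K] (hs : 0 < s) {q : PP K (Fin s → Fin 2)}
    (hq : q ∈ secant k (segX K s)) (v : (Fin s → Fin 2) → K) (hv : v ∈ q.submodule)
    (f : MvPolynomial (Fin s → Fin 2) K) (hf : par K s k f = 0) : MvPolynomial.eval v f = 0 := by
  have hq' : q ∈ zeroLocus {f : MvPolynomial (Fin s → Fin 2) K |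
      (∃ d, f.IsHomogeneous d) ∧ par K s k f = 0} := by
    apply zclosure_min _ ⟨_, fun f hf => hf.1, rfl⟩ hq
    rintro p ⟨S, hS, hc, hp⟩ f ⟨_, hf⟩ v hv
    obtain ⟨z, rfl, _⟩ := exists_rk hs S hS hc.le v (hp hv)
    exact par_rk hf z
  rw [← MvPolynomial.sum_homogeneousComponent f, map_sum]
  refine Finset.sum_eq_zero fun d _ => hq' _
    ⟨⟨d, MvPolynomial.homogeneousComponent_isHomogeneous d f⟩, par_hom hf d⟩ v hv

/-- separation of the points -/
def sep (K : Type u) [Field K] (s k : ℕ) (l : Fin s) : RR K s k :=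
  ∏ i, ∏ j, if i = j then 1 else MvPolynomial.X (i, some l) - MvPolynomial.X (j, some l)

theorem sep_ne (l : Fin s) : sep K s k l ≠ 0 := by
  refine Finset.prod_ne_zero_iff.2 fun i _ => Finset.prod_ne_zero_iff.2 fun j _ => ?_
  split_ifs with h
  · exact one_ne_zero
  · rw [sub_ne_zero]
    intro h'
    have := MvPolynomial.X_injective h'
    simp at this
    exact h this

theorem sep_eval (l : Fin s) (a : Fin k × Option (Fin s) → K)
    (ha : MvPolynomial.eval a (sep K s k l) ≠ 0) :
    Function.Injective fun i => pt fun l => a (i, some l) := by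
  intro i j hij
  by_contra hne
  simp only [sep, map_prod] at ha
  apply Finset.prod_ne_zero_iff.1 (Finset.prod_ne_zero_iff.1 ha i (mem_univ _)) j (mem_univ _)
  rw [if_neg hne]
  simp only [map_sub, MvPolynomial.eval_X]
  have h1 : (pt fun l => a (i, some l)).submodule = (pt fun l => a (j, some l)).submodule :=
    congrArg Projectivization.submodule hij
  have h2 := smul_av_mem (fun l => a (i, some l)) 1
  rw [h1, pt_submodule, Submodule.mem_span_singleton] at h2
  obtain ⟨c, hc⟩ := h2
  have h3 := congrFun hc 0
  have h4 := congrFun hc (E1 l)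
  simp only [Pi.smul_apply, smul_eq_mul, av_zero, av_E1, one_mul, mul_one] at h3 h4
  rw [h3, one_mul] at h4
  rw [h4, sub_self]

/-- the decomposition of a parametrised point -/
def decS (a : Fin k × Option (Fin s) → K) : Finset (PP K (Fin s → Fin 2)) := by
  classical exact univ.image fun i => pt fun l => a (i, some l)

theorem decS_sub (a : Fin k × Option (Fin s) → K) :
    (decS a : Set (PP K (Fin s → Fin 2))) ⊆ segX K s := by
  intro x hx
  simp only [decS, coe_image, Set.mem_image] at hx
  obtain ⟨i, _, rfl⟩ := hx
  exact pt_mem _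

theorem decS_card (l : Fin s) (a : Fin k × Option (Fin s) → K)
    (ha : MvPolynomial.eval a (sep K s k l) ≠ 0) : (decS a).card = k := by
  classical
  rw [decS, Finset.card_image_of_injective _ (sep_eval l a ha)]
  simp

theorem tot_mem (a : Fin k × Option (Fin s) → K) :
    tot a ∈ vspan (decS a : Set (PP K (Fin s → Fin 2))) := by
  have : tot a = ∑ i, a (i, none) • av fun l => a (i, some l) := by
    ext t
    simp [tot, Finset.sum_apply]
  rw [this]
  refine Submodule.sum_mem _ fun i _ => Submodule.subset_span ?_
  simp only [coneOf, Set.mem_iUnion]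
  refine ⟨pt fun l => a (i, some l), ?_, smul_av_mem _ _⟩
  simp [decS]

theorem tot_ne (hk : 1 ≤ k) : (tot MvPolynomial.X 0 : RR K s k) ≠ 0 := by
  intro h
  have := congrArg (MvPolynomial.eval (fun p : Fin k × Option (Fin s) =>
    if p.1 = ⟨0, hk⟩ then (1 : K) else 0)) h
  rw [map_tot] at this
  simp [tot, av_zero] at this

theorem identifiable [IsAlgClosed K] [CharZero K] (s k : ℕ) (hs : 5 ≤ s) (hk : 1 ≤ k)
    (hineq : (k + s - 1) * (s + 1) ≤ 2 ^ s - 1) : Identifiable (segX K s) k := by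
  have : Infinite K := IsAlgClosed.instInfinite
  have hs0 : 0 < s := by omega
  let l0 : Fin s := ⟨0, hs0⟩
  obtain ⟨g, hg, hgood⟩ := exists_good (K := K) s k hs hineq
  obtain ⟨F, hF, hchev⟩ := chevalley (par K s k) (g * sep K s k l0) (mul_ne_zero hg (sep_ne _))
  refine ⟨zeroLocus (Set.range fun d => MvPolynomial.homogeneousComponent d F), ⟨_, ?_, rfl⟩, ?_, ?_⟩
  · rintro _ ⟨d, rfl⟩
    exact ⟨d, MvPolynomial.homogeneousComponent_isHomogeneous d F⟩
  · intro hsub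
    obtain ⟨a, ha⟩ := exists_eval_ne (K := K)
      (mul_ne_zero (mul_ne_zero hF (sep_ne (K := K) (k := k) l0)) (tot_ne (K := K) (s := s) hk))
    change MvPolynomial.eval a _ ≠ 0 at ha
    simp only [map_mul] at ha
    obtain ⟨ha, ha3⟩ := mul_ne_zero_iff.1 ha
    obtain ⟨ha1, ha2⟩ := mul_ne_zero_iff.1 ha
    rw [map_tot] at ha3
    simp only [MvPolynomial.eval_X] at ha3
    rw [eval_par] at ha1
    have hv : tot a ≠ 0 := fun h => ha3 (congrFun h 0)
    have hq := hsub (subset_zclosure _ ⟨decS a, decS_sub a, decS_card l0 a ha2, (by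
      change (Projectivization.mk K (tot a) hv).submodule ≤ _
      rw [Projectivization.submodule_mk, Submodule.span_singleton_le_iff_mem]
      exact tot_mem a)⟩)
    apply ha1
    rw [← MvPolynomial.sum_homogeneousComponent F, map_sum]
    refine Finset.sum_eq_zero fun d _ => hq _ ⟨d, rfl⟩ _ ?_
    rw [Projectivization.submodule_mk]
    exact Submodule.mem_span_singleton_self _
  · rintro q ⟨hq, hqY⟩
    obtain ⟨d, v0, hv0, hd⟩ : ∃ d, ∃ v ∈ q.submodule,
        MvPolynomial.eval v (MvPolynomial.homogeneousComponent d F) ≠ 0 := by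
      by_contra hcon
      push Not at hcon
      apply hqY
      rintro _ ⟨d, rfl⟩ v hv
      exact hcon d v hv
    have hd' := hom_rep_ne (MvPolynomial.homogeneousComponent_isHomogeneous d F) q v0 hv0 hd
    obtain ⟨c, hc0, hc⟩ : ∃ c : K, c ≠ 0 ∧ MvPolynomial.eval (c • q.rep) F ≠ 0 := by
      by_contra hcon
      push Not at hcon
      have : linePoly q.rep F * Polynomial.X = 0 := by
        apply Polynomial.funext
        intro c
        rw [Polynomial.eval_mul, Polynomial.eval_X, linePoly_eval, Polynomial.eval_zero]
        by_cases h : c = 0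
        · rw [h, mul_zero]
        · rw [hcon c h, zero_mul]
      have := (mul_eq_zero.1 this).resolve_right Polynomial.X_ne_zero
      rw [← linePoly_coeff, this] at hd'
      exact hd' (Polynomial.coeff_zero _)
    obtain ⟨a, ha, hG⟩ := hchev (c • q.rep)
      (fun f hf => secant_par hs0 hq _ (Submodule.smul_mem _ _ (rep_mem q)) f hf) hc
    rw [map_mul] at hG
    obtain ⟨hga, hsa⟩ := mul_ne_zero_iff.1 hG
    have hv : tot a = c • q.rep := by
      ext t
      rw [← ha t, eval_par, MvPolynomial.eval_X]
    have hmem : q ∈ projSpan (decS a : Set (PP K (Fin s → Fin 2))) := by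
      change q.submodule ≤ _
      rw [Projectivization.submodule_eq, Submodule.span_singleton_le_iff_mem]
      have : q.rep = c⁻¹ • tot a := by rw [hv, smul_smul, inv_mul_cancel₀ hc0, one_smul]
      rw [this]
      exact Submodule.smul_mem _ _ (tot_mem a)
    have key : ∀ S : Finset (PP K (Fin s → Fin 2)), ↑S ⊆ segX K s → S.card ≤ k →
        q ∈ projSpan (S : Set (PP K (Fin s → Fin 2))) → decS a ⊆ S := by
      intro S hS hcard hqS x hx
      have hvS : tot a ∈ vspan (S : Set (PP K (Fin s → Fin 2))) := by
        rw [hv]; exact Submodule.smul_mem _ _ (hqS (rep_mem q))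
      obtain ⟨z, hz, hz'⟩ := exists_rk hs0 S hS hcard _ hvS
      obtain ⟨hz0, hun⟩ := hgood a hga z (fun t => congrFun hz t)
      simp only [decS, mem_image] at hx
      obtain ⟨i, _, rfl⟩ := hx
      obtain ⟨j, hj⟩ := hun i
      rcases hz' j with h | ⟨x, hxS, hx⟩
      · exact absurd (by rw [h]; rfl) (hz0 j l0)
      · rw [Projectivization.submodule_eq, Submodule.mem_span_singleton] at hx
        obtain ⟨e, he⟩ := hx
        have he0 : e ≠ 0 := by
          rintro rfl
          have := congrFun he 0
          simp only [zero_smul, Pi.zero_apply] at this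
          exact Finset.prod_ne_zero_iff.2 (fun l _ => hz0 j l) this.symm
        obtain ⟨b, _, hb⟩ := pt_rep fun l => a (i, some l)
        have : (pt fun l => a (i, some l)) = x := by
          apply eq_of_minors
          intro t t'
          have h1 := hj t t'
          have h2 := congrFun he t
          have h3 := congrFun he t'
          simp only [Pi.smul_apply, smul_eq_mul] at h2 h3
          rw [← h2, ← h3] at h1
          rw [hb]
          simp only [Pi.smul_apply, smul_eq_mul]
          apply mul_left_cancel₀ he0
          linear_combination b * h1
        rw [this]; exact hxS
    have hcard := decS_card l0 a hsa
    have hrank : xrank (segX K s) q = k := by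
      have hne : k ∈ {k | ∃ S : Finset (PP K (Fin s → Fin 2)), ↑S ⊆ segX K s ∧ S.card = k ∧
          q ∈ projSpan (S : Set (PP K (Fin s → Fin 2)))} := ⟨decS a, decS_sub a, hcard, hmem⟩
      have h1 : xrank (segX K s) q ≤ k := Nat.sInf_le hne
      obtain ⟨S, hS1, hS2, hS3⟩ := Nat.sInf_mem ⟨k, hne⟩
      have h2 : S.card = xrank (segX K s) q := hS2
      have h3 := Finset.card_le_card (key S hS1 (by omega) hS3)
      omega
    refine ⟨decS a, ⟨decS_sub a, by rw [hcard, hrank], hmem⟩, ?_⟩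
    rintro S ⟨hS1, hS2, hS3⟩
    rw [hrank] at hS2
    exact (Finset.eq_of_subset_of_card_le (key S hS1 hS2.le hS3) (by omega)).symm

end ident

end aux

/-- **Corollary (ip4).**  Fix `s ≥ 5` and a positive integer `k` with
`(k+s-1)(s+1) ≤ 2^s - 1`.  Let `X ⊆ ℙ^{2^s-1}` be the Segre embedding of `(ℙ^1)^s`
(char `0`).  Then `X` is not weakly `k`-defective, hence it is `k`-identifiable. -/
theorem statement12 {K : Type*} [Field K] [IsAlgClosed K] [CharZero K]
    (s k : ℕ) (hs : 5 ≤ s) (hk : 1 ≤ k)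
    (hineq : (k + s - 1) * (s + 1) ≤ 2 ^ s - 1) :
    ¬WeaklyDefective (segreVariety K s fun _ => 1) k ∧
      Identifiable (segreVariety K s fun _ => 1) k := by
  have : Infinite K := IsAlgClosed.instInfinite
  exact ⟨not_weaklyDefective s k hs hineq, identifiable s k hs hk hineq⟩

end ContactLoci
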